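/- arXiv:2512.08554 — 5 statements merged into one kernel-verified Lean document; each statement's English description precedes it below -/
import Mathlib

section
/- Let G be a finite simple chordal graph. Then the extended incidence vectors of the induced trees of G form a Hilbert basis of the induced tree cone C_T(G): every integer point (x,y) ∈ Z^V × Z^E lying in C_T(G) can be written as a nonnegative integer combination of extended incidence vectors of induced trees of G. -/
open SimpleGraph Finset
open scoped Classical

/-- A graph has a hole if some set of vertices induces a cycle of length at least 4. -/
def SimpleGraph.HasHole {V : Type*} (G : SimpleGraph V) : Prop :=
  ∃ (W : Set V) (n : ℕ), 4 ≤ n ∧ Nonempty (G.induce W ≃g SimpleGraph.cycleGraph n)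

/-- A graph is chordal if it has no hole. -/
def SimpleGraph.Chordal {V : Type*} (G : SimpleGraph V) : Prop := ¬ G.HasHole

/-- `W` induces a tree in `G`. -/
def SimpleGraph.IsInducedTree {V : Type*} (G : SimpleGraph V) (W : Finset V) : Prop :=
  (G.induce (W : Set V)).IsTree

/-- `W` induces a path in `G`. -/
def SimpleGraph.IsInducedPath {V : Type*} (G : SimpleGraph V) (W : Finset V) : Prop :=
  ∃ n : ℕ, 1 ≤ n ∧ Nonempty (G.induce (W : Set V) ≃g SimpleGraph.pathGraph n)

/-- The extended incidence vector of a vertex set `W`. -/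
noncomputable def SimpleGraph.xi {V : Type*} (G : SimpleGraph V) (W : Finset V) :
    (V → ℝ) × (Sym2 V → ℝ) :=
  (fun v => if v ∈ W then 1 else 0,
   fun e => if e ∈ G.edgeSet ∧ ∀ v ∈ e, v ∈ W then 1 else 0)

/-- `K` is a maximal clique of `G`. -/
def SimpleGraph.IsMaxCliqueF {V : Type*} (G : SimpleGraph V) (K : Finset V) : Prop :=
  G.IsClique (K : Set V) ∧ ∀ K' : Finset V, G.IsClique (K' : Set V) → K ⊆ K' → K' = K

/-- The induced tree cone `C_T(G)`. -/
noncomputable def SimpleGraph.inducedTreeCone {V : Type*} (G : SimpleGraph V) :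
    Set ((V → ℝ) × (Sym2 V → ℝ)) :=
  {p | (∀ v, 0 ≤ p.1 v) ∧ (∀ e, 0 ≤ p.2 e) ∧ (∀ e, e ∉ G.edgeSet → p.2 e = 0) ∧
    ∀ (v : V) (K : Finset V), G.IsMaxCliqueF K → v ∈ K →
      ∑ u ∈ K.erase v, p.2 s(u, v) ≤ p.1 v}

/-- The set of vertices outside `S` complete to `S`. -/
noncomputable def SimpleGraph.completeTo {V : Type*} [Fintype V] (G : SimpleGraph V)
    (S : Finset V) : Finset V :=
  Finset.univ.filter fun v => v ∉ S ∧ ∀ u ∈ S, G.Adj v u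

/-- The induced path cone `C_P(G)`. -/
noncomputable def SimpleGraph.inducedPathCone {V : Type*} [Fintype V] (G : SimpleGraph V) :
    Set ((V → ℝ) × (Sym2 V → ℝ)) :=
  {p | (∀ v, 0 ≤ p.1 v) ∧ (∀ e, 0 ≤ p.2 e) ∧ (∀ e, e ∉ G.edgeSet → p.2 e = 0) ∧
    ∀ (w : V) (K : Finset V), (K : Set V) ⊆ G.neighborSet w → G.IsClique (K : Set V) →
      ∑ u ∈ G.completeTo (insert w K), p.2 s(w, u) + 2 * ∑ u ∈ K, p.2 s(w, u) ≤ 2 * p.1 w}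

/-- The polytope `T(G)`: intersection of `C_T(G)` with the hyperplane `x(V) - y(E) = 1`. -/
noncomputable def SimpleGraph.treePolyT {V : Type*} [Fintype V] (G : SimpleGraph V) :
    Set ((V → ℝ) × (Sym2 V → ℝ)) :=
  {p ∈ G.inducedTreeCone | ∑ v : V, p.1 v - ∑ e : Sym2 V, p.2 e = 1}

/-- The polytope `P(G)`: intersection of `C_P(G)` with the hyperplane `x(V) - y(E) = 1`. -/
noncomputable def SimpleGraph.pathPolyP {V : Type*} [Fintype V] (G : SimpleGraph V) :
    Set ((V → ℝ) × (Sym2 V → ℝ)) :=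
  {p ∈ G.inducedPathCone | ∑ v : V, p.1 v - ∑ e : Sym2 V, p.2 e = 1}

/-- The induced tree polytope: convex hull of extended incidence vectors of induced trees. -/
noncomputable def SimpleGraph.inducedTreePolytope {V : Type*} (G : SimpleGraph V) :
    Set ((V → ℝ) × (Sym2 V → ℝ)) :=
  convexHull ℝ {p | ∃ W : Finset V, G.IsInducedTree W ∧ p = G.xi W}

/-- The induced path polytope: convex hull of extended incidence vectors of induced paths. -/
noncomputable def SimpleGraph.inducedPathPolytope {V : Type*} (G : SimpleGraph V) :
    Set ((V → ℝ) × (Sym2 V → ℝ)) :=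
  convexHull ℝ {p | ∃ W : Finset V, G.IsInducedPath W ∧ p = G.xi W}

/-- `p` is an extreme point of `s`: it cannot be written as the midpoint of two
distinct points of `s`. -/
def IsExtremePt {E : Type*} [AddCommGroup E] [Module ℝ E] (s : Set E) (p : E) : Prop :=
  p ∈ s ∧ ∀ q r : E, q ∈ s → r ∈ s → p = (2⁻¹ : ℝ) • (q + r) → q = r

/-- `u` is an extremity of the induced path `W` (degree at most 1 in the induced subgraph). -/
noncomputable def SimpleGraph.IsExtremity {V : Type*} (G : SimpleGraph V) (u : V)
    (W : Finset V) : Prop :=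
  u ∈ W ∧ (W.filter fun w => G.Adj u w).card ≤ 1

/-- The neighborhood of `v` as a `Finset`. -/
noncomputable def SimpleGraph.nbrF {V : Type*} [Fintype V] (G : SimpleGraph V) (v : V) :
    Finset V :=
  Finset.univ.filter fun u => G.Adj v u

/-- `K` defines an orbit of `w`. -/
noncomputable def SimpleGraph.DefinesOrbit {V : Type*} [Fintype V] (G : SimpleGraph V)
    (w : V) (K : Finset V) : Prop :=
  (K : Set V) ⊆ G.neighborSet w ∧ G.IsClique (K : Set V) ∧
    ¬ ∃ K' : Finset V, (K' : Set V) ⊆ G.neighborSet w ∧ G.IsClique (K' : Set V) ∧ K ⊂ K' ∧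
      insert w K ∪ G.completeTo (insert w K) ⊆ insert w K' ∪ G.completeTo (insert w K')

namespace SimpleGraph

variable {V : Type*} {G : SimpleGraph V}

theorem Walk.dist_getVert_of_length_eq_dist {a b : V} (p : G.Walk a b)
    (hp : p.length = G.dist a b) {i : ℕ} (hi : i ≤ p.length) : G.dist a (p.getVert i) = i := by
  have h₁ : G.dist a (p.getVert i) ≤ i := by
    simpa [hi] using dist_le (p.take i)
  have h₂ : G.dist (p.getVert i) b ≤ p.length - i := by
    simpa using dist_le (p.drop i)
  have h₃ := (p.take i).reachable.dist_triangle_left b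
  omega

/-- In a chordal graph, two common neighbours of `v` joined by a path whose inner vertices are not
adjacent to `v` are adjacent. -/
theorem Chordal.adj_of_reachable (hG : G.Chordal) {v : V} {S : Set V} {a b : S}
    (hvS : v ∉ S) (hS : ∀ c : S, G.Adj v c → c = a ∨ c = b) (ha : G.Adj v a) (hb : G.Adj v b)
    (hab : a ≠ b) (h : (G.induce S).Reachable a b) : G.Adj a b := by
  by_contra hnadj
  obtain ⟨p, hp⟩ := h.exists_walk_length_eq_dist
  have hk : 1 < p.length := hp ▸ h.one_lt_dist_of_ne_of_not_adj hab (by simpa using hnadj)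
  have hd : ∀ i ≤ p.length, (G.induce S).dist a (p.getVert i) = i :=
    fun i hi ↦ p.dist_getVert_of_length_eq_dist hp hi
  have hinj : ∀ i ≤ p.length, ∀ j ≤ p.length, p.getVert i = p.getVert j → i = j := by
    intro i hi j hj hij
    rw [← hd i hi, ← hd j hj, hij]
  have hpath : ∀ i ≤ p.length, ∀ j ≤ p.length,
      (G.Adj (p.getVert i) (p.getVert j) ↔ j = i + 1 ∨ i = j + 1) := by
    intro i hi j hj
    constructor
    · intro hadj
      have h₁ : (G.induce S).Adj (p.getVert i) (p.getVert j) := hadj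
      have h₂ := h₁.diff_dist_adj (u := a)
      have h₃ : i ≠ j := by
        rintro rfl
        exact hadj.ne rfl
      rw [hd i hi, hd j hj] at h₂
      omega
    · rintro (rfl | rfl)
      · exact p.adj_getVert_succ (by omega)
      · exact (p.adj_getVert_succ (by omega)).symm
  have hv : ∀ i ≤ p.length, (G.Adj v (p.getVert i) ↔ i = 0 ∨ i = p.length) := by
    intro i hi
    constructor
    · intro hadj
      rcases hS _ hadj with h' | h'
      · exact .inl (hinj i hi 0 (by omega) (by simpa using h'))
      · exact .inr (hinj i hi _ le_rfl (by simpa using h'))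
    · rintro (rfl | rfl) <;> simpa
  have hne : ∀ i, (p.getVert i : V) ≠ v := fun i h' ↦ hvS (h' ▸ (p.getVert i).2)
  let f : cycleGraph (p.length + 2) ↪g G :=
    { toFun := fun i ↦ if i.val ≤ p.length then p.getVert i else v
      inj' := by
        intro i j hij
        have := hne i
        have := hne j
        have := i.2
        have := j.2
        ext
        dsimp only at hij
        split_ifs at hij with hi hj hj
        · exact hinj _ hi _ hj (Subtype.ext hij)
        · exact absurd hij ‹_›
        · exact absurd hij.symm ‹_›
        · omega
      map_rel_iff' := by
        intro i j
        have hi' := i.2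
        have hj' := j.2
        rw [cycleGraph_adj']
        have hsub : ∀ i j : Fin (p.length + 2), (i - j).val = 1 ↔
            i.val = j.val + 1 ∨ (i.val = 0 ∧ j.val = p.length + 1) := by
          intro i j
          have hi' := i.2
          have hj' := j.2
          rw [Fin.sub_def]
          dsimp only
          rcases le_or_gt j.val i.val with hij | hij
          · rw [show p.length + 2 - j.val + i.val = i.val - j.val + (p.length + 2) by omega,
              Nat.add_mod_right, Nat.mod_eq_of_lt (by omega)]
            omega
          · rw [Nat.mod_eq_of_lt (by omega)]
            omega
        rw [hsub, hsub]
        change G.Adj (if i.val ≤ p.length then (p.getVert i : V) else v)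
          (if j.val ≤ p.length then (p.getVert j : V) else v) ↔ _
        split_ifs with hi hj hj
        · rw [hpath _ hi _ hj]
          omega
        · rw [G.adj_comm, hv _ hi]
          omega
        · rw [hv _ hj]
          omega
        · simp only [SimpleGraph.irrefl, false_iff]
          omega }
  exact hG ⟨_, _, by omega, ⟨f.isoInduceRange.symm⟩⟩

/-- Adding a pendant vertex to an induced tree gives an induced tree. -/
theorem IsInducedTree.insert_pendant {W : Finset V} (hW : G.IsInducedTree W) {u v : V} (hu : u ∈ W)
    (huv : G.Adj u v) (h : ∀ w ∈ W, G.Adj w v → w = u) :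
    G.IsInducedTree (insert v W) := by
  have hS : ((insert v W : Finset V) : Set V) = (W : Set V) ∪ {v} := by
    ext; simp
  unfold IsInducedTree
  refine ⟨?_, ?_⟩
  · rw [hS]
    exact connected_induce_union hW.1.preconnected .of_subsingleton hu rfl huv
  · intro x c hc
    by_cases hvc : ∃ y ∈ c.support, y.val = v
    · obtain ⟨y, hy, hyv⟩ := hvc
      have hc' := hc.rotate hy
      have key : ∀ z, (G.induce _).Adj y z → z.val = u := by
        intro z hz
        have hz' : G.Adj y z := hz
        rw [hyv] at hz'
        refine h z ?_ hz'.symm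
        have := z.2
        simp only [Finset.coe_insert, Set.mem_insert_iff] at this
        exact this.resolve_left hz'.ne'
      refine hc'.snd_ne_penultimate (Subtype.ext ?_)
      rw [key _ (Walk.adj_snd hc'.not_nil), key _ (Walk.adj_penultimate hc'.not_nil).symm]
    · push Not at hvc
      let e : G.induce ((insert v W : Finset V) : Set V) ↪g G := Embedding.induce _
      have hcyc : (c.map e.toHom).IsCycle := hc.map e.injective
      have hsup : ∀ y ∈ (c.map e.toHom).support, y ∈ (W : Set V) := by
        intro y hy
        rw [Walk.support_map, List.mem_map] at hy
        obtain ⟨z, hz, rfl⟩ := hy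
        have := z.2
        simp only [Finset.coe_insert, Set.mem_insert_iff] at this
        exact this.resolve_left (hvc z hz)
      refine hW.2 ((c.map e.toHom).induce _ hsup) (Walk.IsCycle.of_map
        (f := (Embedding.induce (G := G) (W : Set V)).toHom) ?_)
      rw [Walk.map_induce]
      exact hcyc

theorem IsInducedTree.singleton (v : V) : G.IsInducedTree {v} := by
  have : Subsingleton ((({v} : Finset V) : Set V)) := by simp
  have : Nonempty ((({v} : Finset V) : Set V)) := by simp
  exact IsTree.of_subsingleton


/-- In a chordal graph, a vertex `v` of `A` that is not adjacent to all other vertices of `A` has a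
non-neighbour that is simplicial in `A`. -/
theorem Chordal.exists_isClique_neighbors_not_adj (hG : G.Chordal) (A : Finset V) {v w : V}
    (hv : v ∈ A) (hw : w ∈ A) (hwv : w ≠ v) (hnadj : ¬G.Adj v w) :
    ∃ u ∈ A, u ≠ v ∧ ¬G.Adj v u ∧ G.IsClique {x | x ∈ A ∧ G.Adj u x} := by
  induction A using Finset.strongInduction generalizing v w with
  | H A ih =>
  let D : Set V := {x | x ∈ A ∧ x ≠ v ∧ ¬G.Adj v x}
  let w' : D := ⟨w, hw, hwv, hnadj⟩
  let C : Finset V := {x ∈ A | ∃ hx : x ∈ D, (G.induce D).Reachable w' ⟨x, hx⟩}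
  let S : Finset V := {s ∈ A | G.Adj v s ∧ ∃ c ∈ C, G.Adj s c}
  have hCD : ∀ c ∈ C, c ∈ D := fun c hc ↦ (Finset.mem_filter.1 hc).2.1
  have hwC : w ∈ C := Finset.mem_filter.2 ⟨hw, w'.2, .refl _⟩
  have hclosed : ∀ c ∈ C, ∀ x ∈ A, G.Adj c x → x ∈ C ∪ S := by
    intro c hc x hx hcx
    obtain ⟨hcA, hcD, hreach⟩ := Finset.mem_filter.1 hc
    rw [Finset.mem_union]
    by_cases hvx : G.Adj v x
    · exact .inr (Finset.mem_filter.2 ⟨hx, hvx, c, hc, hcx.symm⟩)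
    · have hxD : x ∈ D := ⟨hx, fun h ↦ hcD.2.2 (h ▸ hcx.symm), hvx⟩
      have hadj : (G.induce D).Adj ⟨c, hcD⟩ ⟨x, hxD⟩ := hcx
      exact .inl (Finset.mem_filter.2 ⟨hx, hxD, hreach.trans hadj.reachable⟩)
  have hS : G.IsClique (S : Set V) := by
    intro a ha b hb hab
    obtain ⟨-, hva, c, hc, hac⟩ := Finset.mem_filter.1 (Finset.mem_coe.1 ha)
    obtain ⟨-, hvb, d, hd, hbd⟩ := Finset.mem_filter.1 (Finset.mem_coe.1 hb)
    obtain ⟨-, hcD, hwc⟩ := Finset.mem_filter.1 hc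
    obtain ⟨-, hdD, hwd⟩ := Finset.mem_filter.1 hd
    let E : Set V := D ∪ {a, b}
    have hDE : D ≤ E := Set.subset_union_left
    have haE : a ∈ E := .inr (.inl rfl)
    have hbE : b ∈ E := .inr (.inr rfl)
    refine hG.adj_of_reachable (S := E) (a := ⟨a, haE⟩) (b := ⟨b, hbE⟩) (v := v)
      ?_ ?_ hva hvb (by simpa using hab) ?_
    · rintro (h | rfl | rfl)
      · exact h.2.1 rfl
      · exact hva.ne rfl
      · exact hvb.ne rfl
    · rintro ⟨x, h | rfl | rfl⟩ hx
      · exact absurd hx h.2.2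
      · exact .inl rfl
      · exact .inr rfl
    · have h₁ : (G.induce E).Adj ⟨a, haE⟩ ⟨c, hDE hcD⟩ := hac
      have h₂ : (G.induce E).Adj ⟨b, hbE⟩ ⟨d, hDE hdD⟩ := hbd
      have h₃ := (hwc.symm.trans hwd).map (G.induceHomOfLE hDE).toHom
      exact (h₁.reachable.trans h₃).trans h₂.reachable.symm
  suffices h : ∃ u ∈ C, G.IsClique {x | x ∈ C ∪ S ∧ G.Adj u x} by
    obtain ⟨u, hu, hclique⟩ := h
    have huD := hCD u hu
    refine ⟨u, huD.1, huD.2.1, huD.2.2, hclique.subset ?_⟩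
    rintro x ⟨hx, hux⟩
    exact ⟨hclosed u hu x hx hux, hux⟩
  by_cases hB : G.IsClique ((C ∪ S : Finset V) : Set V)
  · exact ⟨w, hwC, hB.subset fun x hx ↦ hx.1⟩
  have hBA : C ∪ S ⊂ A := by
    refine Finset.ssubset_iff_subset_ne.2
      ⟨Finset.union_subset (Finset.filter_subset _ _) (Finset.filter_subset _ _), fun h ↦ ?_⟩
    rw [← h, Finset.mem_union] at hv
    rcases hv with hv | hv
    · exact (hCD v hv).2.1 rfl
    · exact (Finset.mem_filter.1 hv).2.1.ne rfl
  have key : ∀ s ∈ S, ∀ t ∈ C ∪ S, t ≠ s → ¬G.Adj s t →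
      ∃ u ∈ C, G.IsClique {x | x ∈ C ∪ S ∧ G.Adj u x} := by
    intro s hs t ht hts hst
    obtain ⟨u, hu, hus, hsu, hclique⟩ := ih _ hBA (Finset.mem_union_right _ hs) ht hts hst
    refine ⟨u, (Finset.mem_union.1 hu).resolve_right fun huS ↦ hsu (hS hs huS hus.symm), hclique⟩
  simp only [IsClique, Set.Pairwise, not_forall] at hB
  obtain ⟨x, hx, y, hy, hxy, hnxy⟩ := hB
  obtain ⟨u, hu, hux, hxu, hclique⟩ := ih _ hBA hx hy (Ne.symm hxy) hnxy
  rcases Finset.mem_union.1 hu with huC | huS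
  · exact ⟨u, huC, hclique⟩
  · exact key u huS x hx hux.symm fun h ↦ hxu h.symm

/-- Every nonempty finite vertex set of a chordal graph contains a simplicial vertex. -/
theorem Chordal.exists_isClique_neighbors (hG : G.Chordal) {A : Finset V} (hA : A.Nonempty) :
    ∃ u ∈ A, G.IsClique {x | x ∈ A ∧ G.Adj u x} := by
  by_cases h : G.IsClique (A : Set V)
  · obtain ⟨u, hu⟩ := hA
    exact ⟨u, hu, h.subset fun x hx ↦ hx.1⟩
  · simp only [IsClique, Set.Pairwise, not_forall] at h
    obtain ⟨x, hx, y, hy, hxy, hnxy⟩ := h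
    obtain ⟨u, hu, -, -, hclique⟩ :=
      hG.exists_isClique_neighbors_not_adj A hx hy (Ne.symm hxy) hnxy
    exact ⟨u, hu, hclique⟩

/-- Weights on the vertices and edges of a chordal graph satisfying all clique inequalities inside
`A` are the multiplicities in a finite family of induced trees contained in `A`. -/
theorem Chordal.exists_family_isInducedTree (hG : G.Chordal) (x : V → ℕ) (y : Sym2 V → ℕ)
    (A : Finset V) (h : ∀ K ⊆ A, G.IsClique (K : Set V) → ∀ v ∈ K,
      ∑ u ∈ K.erase v, y s(u, v) ≤ x v) :
    ∃ (ι : Type) (_ : Fintype ι) (T : ι → Finset V),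
      (∀ i, T i ⊆ A ∧ G.IsInducedTree (T i)) ∧
      (∀ v ∈ A, #{i | v ∈ T i} = x v) ∧
      ∀ u ∈ A, ∀ v ∈ A, G.Adj u v → #{i | u ∈ T i ∧ v ∈ T i} = y s(u, v) := by
  induction A using Finset.strongInduction with
  | H A ih =>
  rcases A.eq_empty_or_nonempty with rfl | hA
  · exact ⟨Empty, inferInstance, fun _ ↦ ∅, by simp, by simp, by simp⟩
  obtain ⟨v, hv, hclique⟩ := hG.exists_isClique_neighbors hA
  obtain ⟨ι, _, T, hT, hTx, hTy⟩ := ih (A.erase v) (Finset.erase_ssubset hv)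
    fun K hK ↦ h K (hK.trans (Finset.erase_subset _ _))
  let N : Finset V := {u ∈ A | G.Adj v u}
  have hN : ∀ {u}, u ∈ N ↔ u ∈ A ∧ G.Adj v u := Finset.mem_filter
  have hNv : v ∉ N := fun h ↦ (hN.1 h).2.ne rfl
  have hNA : ∀ u ∈ N, u ∈ A.erase v := fun u hu ↦
    Finset.mem_erase.2 ⟨fun h ↦ hNv (h ▸ hu), (hN.1 hu).1⟩
  have hNclique : G.IsClique (N : Set V) := hclique.subset fun u hu ↦ hN.1 hu
  have hNclique' : G.IsClique ((insert v N : Finset V) : Set V) := by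
    rw [Finset.coe_insert, isClique_insert]
    exact ⟨hNclique, fun u hu _ ↦ (hN.1 hu).2⟩
  have hNsub : insert v N ⊆ A := Finset.insert_subset hv (Finset.filter_subset _ _)
  have hvT : ∀ i, v ∉ T i := fun i hi ↦ Finset.notMem_erase v A ((hT i).1 hi)
  have hroom : ∀ u ∈ N, y s(u, v) ≤ #{i | u ∈ T i ∧ ∀ w ∈ N, w ∈ T i → w = u} := by
    intro u hu
    have hle := h _ hNsub hNclique' u (Finset.mem_insert_of_mem hu)
    have hvu : v ≠ u := fun h ↦ hNv (h ▸ hu)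
    rw [Finset.erase_insert_of_ne hvu, Finset.sum_insert fun h ↦ hNv (Finset.mem_of_mem_erase h),
      Sym2.eq_swap, ← hTx u (hNA u hu)] at hle
    have hcover : (Finset.univ.filter fun i ↦ u ∈ T i) ⊆
        (Finset.univ.filter fun i ↦ u ∈ T i ∧ ∀ w ∈ N, w ∈ T i → w = u) ∪
          (N.erase u).biUnion fun w ↦ Finset.univ.filter fun i ↦ w ∈ T i ∧ u ∈ T i := by
      intro i hi
      simp only [Finset.mem_union, Finset.mem_filter, Finset.mem_univ, true_and,
        Finset.mem_biUnion, Finset.mem_erase] at hi ⊢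
      grind
    have hcard := (Finset.card_le_card hcover).trans
      ((Finset.card_union_le _ _).trans (Nat.add_le_add_left Finset.card_biUnion_le _))
    have hsum : ∑ w ∈ N.erase u, #{i | w ∈ T i ∧ u ∈ T i} = ∑ w ∈ N.erase u, y s(w, u) :=
      Finset.sum_congr rfl fun w hw ↦ by
        obtain ⟨hwu, hwN⟩ := Finset.mem_erase.1 hw
        exact hTy w (hNA w hwN) u (hNA u hu) (hNclique hwN hu hwu)
    rw [hsum] at hcard
    omega
  have hchoose : ∀ u, ∃ s : Finset ι, u ∈ N →
      (∀ i ∈ s, u ∈ T i ∧ ∀ w ∈ N, w ∈ T i → w = u) ∧ #s = y s(u, v) := by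
    intro u
    by_cases hu : u ∈ N
    · obtain ⟨s, hs, hcard⟩ := Finset.exists_subset_card_eq (hroom u hu)
      exact ⟨s, fun _ ↦ ⟨fun i hi ↦ (Finset.mem_filter.1 (hs hi)).2, hcard⟩⟩
    · exact ⟨∅, fun h ↦ absurd h hu⟩
  choose s hs using hchoose
  let M : Finset ι := N.biUnion s
  have hMcard : #M = ∑ u ∈ N, y s(u, v) := by
    rw [Finset.card_biUnion]
    · exact Finset.sum_congr rfl fun u hu ↦ (hs u hu).2
    · intro u hu w hw huw
      rw [Function.onFun, Finset.disjoint_left]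
      intro i hi hi'
      exact huw (((hs w hw).1 i hi').2 u hu ((hs u hu).1 i hi).1)
  have hxv : ∑ u ∈ N, y s(u, v) ≤ x v := by
    simpa [Finset.erase_insert hNv] using h _ hNsub hNclique' v (Finset.mem_insert_self _ _)
  let T' : ι ⊕ Fin (x v - #M) → Finset V :=
    Sum.elim (fun i ↦ if i ∈ M then insert v (T i) else T i) fun _ ↦ {v}
  have hmemv : ∀ i, v ∈ T' (.inl i) ↔ i ∈ M := by
    intro i
    by_cases hi : i ∈ M <;> simp [T', hi, hvT]
  have hmem : ∀ i, ∀ u ≠ v, u ∈ T' (.inl i) ↔ u ∈ T i := by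
    intro i u hu
    by_cases hi : i ∈ M <;> simp [T', hi, hu]
  have hcount : ∀ (P : Finset V → Prop) [DecidablePred P], #{i | P (T' i)} =
      #{i | P (T' (.inl i))} + if P {v} then x v - #M else 0 := by
    intro P _
    simp only [Finset.card_filter, Fintype.sum_sum_type]
    congr 1
    split_ifs with hP <;> simp [T', hP]
  have hpair : ∀ u ∈ A, G.Adj u v → #{i | u ∈ T' i ∧ v ∈ T' i} = y s(u, v) := by
    intro u hu huv
    have huN : u ∈ N := hN.2 ⟨hu, huv.symm⟩
    rw [hcount fun W ↦ u ∈ W ∧ v ∈ W, if_neg (by simpa using huv.ne), add_zero, ← (hs u huN).2]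
    congr 1
    ext i
    simp only [Finset.mem_filter, Finset.mem_univ, true_and, hmemv, hmem i u huv.ne]
    constructor
    · rintro ⟨hui, hiM⟩
      obtain ⟨w, hw, hiw⟩ := Finset.mem_biUnion.1 hiM
      rwa [((hs w hw).1 i hiw).2 u huN hui]
    · exact fun hi ↦ ⟨((hs u huN).1 i hi).1, Finset.mem_biUnion.2 ⟨u, huN, hi⟩⟩
  refine ⟨ι ⊕ Fin (x v - #M), inferInstance, T', ?_, ?_, ?_⟩
  · rintro (i | i)
    · have hTA := (hT i).1.trans (Finset.erase_subset _ _)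
      by_cases hi : i ∈ M
      · obtain ⟨u, hu, hiu⟩ := Finset.mem_biUnion.1 hi
        obtain ⟨huT, huniq⟩ := (hs u hu).1 i hiu
        simp only [T', Sum.elim_inl, if_pos hi]
        exact ⟨Finset.insert_subset hv hTA, (hT i).2.insert_pendant huT (hN.1 hu).2.symm
          fun w hw hwv ↦ huniq w (hN.2 ⟨hTA hw, hwv.symm⟩) hw⟩
      · simpa [T', hi] using ⟨hTA, (hT i).2⟩
    · simpa [T', hv] using IsInducedTree.singleton v
  · intro u hu
    rw [hcount fun W ↦ u ∈ W]
    by_cases huv : u = v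
    · subst huv
      simp only [hmemv, Finset.mem_singleton, if_true, Finset.filter_univ_mem]
      omega
    · simp only [hmem _ u huv, Finset.mem_singleton, if_neg huv, add_zero]
      exact hTx u (Finset.mem_erase.2 ⟨huv, hu⟩)
  · intro u hu w hw huw
    by_cases hwv : w = v
    · subst hwv
      exact hpair u hu huw
    by_cases huv : u = v
    · subst huv
      rw [Sym2.eq_swap, ← hpair w hw huw.symm]
      simp only [and_comm]
    · rw [hcount fun W ↦ u ∈ W ∧ w ∈ W, if_neg fun h ↦ huv (by simpa using h.1), add_zero]
      simp only [hmem _ u huv, hmem _ w hwv]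
      exact hTy u (Finset.mem_erase.2 ⟨huv, hu⟩) w (Finset.mem_erase.2 ⟨hwv, hw⟩) huw

theorem IsClique.exists_isMaxCliqueF [Fintype V] {K : Finset V} (hK : G.IsClique (K : Set V)) :
    ∃ K', K ⊆ K' ∧ G.IsMaxCliqueF K' := by
  obtain ⟨K', hKK', hmax⟩ :=
    Finite.exists_le_maximal (p := fun K : Finset V ↦ G.IsClique (K : Set V)) hK
  exact ⟨K', hKK', hmax.1, fun L hL hle ↦ (hmax.eq_of_le hL hle).symm⟩

end SimpleGraph

/-- In a chordal graph, the extended incidence vectors of induced trees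
form a Hilbert basis of the induced tree cone `C_T(G)`. -/
theorem inducedTrees_form_hilbert_basis {V : Type*} [Fintype V]
    (G : SimpleGraph V) (hG : G.Chordal)
    (p : (V → ℝ) × (Sym2 V → ℝ)) (hp : p ∈ G.inducedTreeCone)
    (hx : ∀ v, ∃ n : ℤ, p.1 v = n) (hy : ∀ e, ∃ n : ℤ, p.2 e = n) :
    ∃ lam : Finset V → ℕ, (∀ W, lam W ≠ 0 → G.IsInducedTree W) ∧
      p = ∑ W : Finset V, (lam W : ℝ) • G.xi W := by
  obtain ⟨hx₀, hy₀, hy₁, hK⟩ := hp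
  have hx' : ∀ v, ∃ n : ℕ, p.1 v = n := fun v ↦ by
    obtain ⟨n, hn⟩ := hx v
    have h₀ := hx₀ v
    rw [hn, Int.cast_nonneg_iff] at h₀
    lift n to ℕ using h₀
    exact ⟨n, by simpa using hn⟩
  have hy' : ∀ e, ∃ n : ℕ, p.2 e = n := fun e ↦ by
    obtain ⟨n, hn⟩ := hy e
    have h₀ := hy₀ e
    rw [hn, Int.cast_nonneg_iff] at h₀
    lift n to ℕ using h₀
    exact ⟨n, by simpa using hn⟩
  choose x hx' using hx'
  choose y hy' using hy'
  obtain ⟨ι, _, T, hT, hTx, hTy⟩ := hG.exists_family_isInducedTree x y Finset.univ (by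
    intro K _ hclique v hv
    obtain ⟨K', hKK', hmax⟩ := hclique.exists_isMaxCliqueF
    have hle := hK v K' hmax (hKK' hv)
    simp only [hx', hy'] at hle
    exact (Finset.sum_le_sum_of_subset (Finset.erase_subset_erase v hKK')).trans
      (by exact_mod_cast hle))
  have hfiber : ∀ f : Finset V → ℝ, ∑ W, (#{i | T i = W} : ℝ) * f W = ∑ i, f (T i) := by
    intro f
    rw [← Finset.sum_fiberwise Finset.univ T]
    refine Finset.sum_congr rfl fun W _ ↦ ?_
    rw [← nsmul_eq_mul, ← Finset.sum_const]
    exact Finset.sum_congr rfl fun i hi ↦ by rw [(Finset.mem_filter.1 hi).2]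
  refine ⟨fun W ↦ #{i | T i = W}, fun W hW ↦ ?_, Prod.ext ?_ ?_⟩
  · obtain ⟨i, hi⟩ := Finset.card_ne_zero.1 hW
    exact (Finset.mem_filter.1 hi).2 ▸ (hT i).2
  · ext v
    simp only [Prod.fst_sum, Finset.sum_apply, Prod.smul_fst, Pi.smul_apply, smul_eq_mul, hfiber]
    simp [SimpleGraph.xi, hx', ← hTx v (Finset.mem_univ v)]
  · ext e
    simp only [Prod.snd_sum, Finset.sum_apply, Prod.smul_snd, Pi.smul_apply, smul_eq_mul, hfiber]
    by_cases he : e ∈ G.edgeSet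
    · induction e with
      | h u v =>
        simp [SimpleGraph.xi, hy', G.mem_edgeSet.1 he,
          ← hTy u (Finset.mem_univ u) v (Finset.mem_univ v) he]
    · simp [SimpleGraph.xi, hy₁ e he, he]
end

section
/- Let G be a finite simple chordal graph and let k be a positive integer. Every integer point of the dilation k·P_T(G) of the induced tree polytope P_T(G) of G is the sum of k extended incidence vectors of induced trees of G; in particular the induced tree polytope of a chordal graph has the integer decomposition property. -/
open SimpleGraph Finset
open scoped Classical

namespace SimpleGraph
variable {V : Type*} {G : SimpleGraph V}

theorem Walk.getVert_adj_le_succ_of_length_eq_dist {a b : V} (p : G.Walk a b)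
    (hp : p.length = G.dist a b) {i j : ℕ} (hj : j ≤ p.length)
    (h : G.Adj (p.getVert i) (p.getVert j)) : j ≤ i + 1 := by
  have := dist_le ((p.take i).append (Walk.cons h (p.drop j)))
  simp [Walk.take_length, Walk.drop_length] at this
  omega

/-- In a chordal graph, the endpoints of a path whose interior avoids the neighborhood of a common
neighbor `v` of the endpoints are adjacent. -/
theorem Chordal.adj_of_reachable_s1 (hG : G.Chordal) {v a b : V} (hab : a ≠ b) (hva : G.Adj v a)
    (hvb : G.Adj v b) {H : SimpleGraph V} {C : Set V} (hvC : v ∉ C) (hC : ∀ c ∈ C, ¬ G.Adj v c)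
    (hH : ∀ x y, H.Adj x y ↔
      G.Adj x y ∧ (x = a ∨ x = b ∨ x ∈ C) ∧ (y = a ∨ y = b ∨ y ∈ C))
    (hr : H.Reachable a b) : G.Adj a b := by
  by_contra hn
  obtain ⟨p, hp⟩ := hr.exists_walk_length_eq_dist
  have hpath := p.isPath_of_length_eq_dist hp
  have hinj := hpath.getVert_injOn
  have h0 : p.getVert 0 = a := p.getVert_zero
  have h1 : p.getVert p.length = b := p.getVert_length
  have hsupp : ∀ i ≤ p.length, p.getVert i = a ∨ p.getVert i = b ∨ p.getVert i ∈ C := by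
    intro i hi
    rcases Nat.lt_or_ge i p.length with h | h
    · exact ((hH _ _).1 (p.adj_getVert_succ h)).2.1
    · have : i = p.length := by omega
      simp [this]
  have hlen : 2 ≤ p.length := by
    by_contra hlt
    have h01 : p.length = 0 ∨ p.length = 1 := by omega
    rcases h01 with h | h
    · rw [h] at h1; exact hab (h0.symm.trans h1)
    · have := p.adj_getVert_succ (i := 0) (by omega)
      rw [h] at h1
      simp only [Nat.zero_add, h0, h1] at this
      exact hn ((hH _ _).1 this).1
  have hadj : ∀ i j, i < j → j ≤ p.length →
      (G.Adj (p.getVert i) (p.getVert j) ↔ j = i + 1) := by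
    intro i j hij hj
    constructor
    · intro h
      have := p.getVert_adj_le_succ_of_length_eq_dist hp hj
        ((hH _ _).2 ⟨h, hsupp i (by omega), hsupp j hj⟩)
      omega
    · rintro rfl
      exact ((hH _ _).1 (p.adj_getVert_succ (by omega))).1
  have hv : ∀ i ≤ p.length, (G.Adj v (p.getVert i) ↔ i = 0 ∨ i = p.length) := by
    intro i hi
    constructor
    · intro h
      rcases hsupp i hi with h' | h' | h'
      · left; exact hinj hi (Nat.zero_le _) (h'.trans h0.symm)
      · right; exact hinj hi (le_refl p.length) (h'.trans h1.symm)
      · exact absurd h (hC _ h')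
    · rintro (rfl | rfl)
      · rwa [h0]
      · rwa [h1]
  have hne : ∀ i ≤ p.length, p.getVert i ≠ v := by
    intro i hi h
    rcases hsupp i hi with h' | h' | h'
    · exact hva.ne (h.symm.trans h')
    · exact hvb.ne (h.symm.trans h')
    · exact hvC (h ▸ h')
  let f : Fin (p.length + 2) → V := fun i => if i.1 ≤ p.length then p.getVert i.1 else v
  have hf : Function.Injective f := by
    intro i j hij
    have hi := i.2
    have hj := j.2
    simp only [f] at hij
    split_ifs at hij with h h' h'
    · exact Fin.ext (hinj h h' hij)
    · exact absurd hij (hne _ h)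
    · exact absurd hij.symm (hne _ h')
    · exact Fin.ext (by omega)
  have hcyc : ∀ i j : Fin (p.length + 2), i < j →
      ((cycleGraph (p.length + 2)).Adj i j ↔ j.1 = i.1 + 1 ∨ (i.1 = 0 ∧ j.1 = p.length + 1)) := by
    intro i j hij
    have hi := i.2
    have hj := j.2
    have hij' : i.1 < j.1 := hij
    rw [cycleGraph_adj', Fin.sub_val_of_le hij.le, Fin.val_sub]
    rw [Nat.mod_eq_of_lt (by omega)]
    omega
  have hiff : ∀ i j : Fin (p.length + 2), i < j →
      (G.Adj (f i) (f j) ↔ (cycleGraph (p.length + 2)).Adj i j) := by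
    intro i j hij
    have hi := i.2
    have hj := j.2
    have hij' : i.1 < j.1 := hij
    rw [hcyc i j hij]
    simp only [f]
    rw [if_pos (by omega : i.1 ≤ p.length)]
    split_ifs with h
    · rw [hadj _ _ hij' h]; omega
    · rw [G.adj_comm, hv _ (by omega)]; omega
  have hiff' : ∀ i j : Fin (p.length + 2),
      (G.Adj (f i) (f j) ↔ (cycleGraph (p.length + 2)).Adj i j) := by
    intro i j
    rcases lt_trichotomy i j with h | rfl | h
    · exact hiff i j h
    · simp
    · rw [G.adj_comm, (cycleGraph _).adj_comm]; exact hiff j i h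
  refine hG ⟨Set.range f, p.length + 2, by omega, ⟨RelIso.symm ⟨Equiv.ofInjective f hf, ?_⟩⟩⟩
  intro i j
  simpa using hiff' i j

theorem Chordal.exists_simplicial_not_adj (hG : G.Chordal) (S : Finset V) :
    ∀ v ∈ S, (∃ u ∈ S, u ≠ v ∧ ¬ G.Adj v u) →
      ∃ s ∈ S, s ≠ v ∧ ¬ G.Adj v s ∧ G.IsClique {w | w ∈ S ∧ G.Adj s w} := by
  induction S using Finset.strongInduction with
  | H S ih =>
  rintro v hv ⟨u, hu, huv, hvu⟩
  let D : Set V := {x | x ∈ S ∧ x ≠ v ∧ ¬ G.Adj v x}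
  let Q : SimpleGraph V :=
    { Adj x y := G.Adj x y ∧ x ∈ D ∧ y ∈ D
      symm := ⟨fun x y h => ⟨h.1.symm, h.2.2, h.2.1⟩⟩
      loopless := ⟨fun x h => h.1.ne rfl⟩ }
  let C : Set V := {x | x ∈ D ∧ Q.Reachable u x}
  let A : Set V := {x | x ∈ S ∧ G.Adj v x ∧ ∃ c ∈ C, G.Adj x c}
  have hclosed : ∀ c ∈ C, ∀ w ∈ S, G.Adj c w → w ∈ C ∨ w ∈ A := by
    intro c hc w hw hcw
    by_cases hvw : G.Adj v w
    · exact Or.inr ⟨hw, hvw, c, hc, hcw.symm⟩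
    · have hwv : w ≠ v := by
        rintro rfl
        exact hc.1.2.2 hcw.symm
      have hwD : w ∈ D := ⟨hw, hwv, hvw⟩
      have : Q.Adj c w := ⟨hcw, hc.1, hwD⟩
      exact Or.inl ⟨hwD, hc.2.trans this.reachable⟩
  have hA : G.IsClique A := by
    intro a ha b hb hab
    obtain ⟨-, hva, ca, hca, haca⟩ := ha
    obtain ⟨-, hvb, cb, hcb, hbcb⟩ := hb
    let H : SimpleGraph V :=
      { Adj x y := G.Adj x y ∧ (x = a ∨ x = b ∨ x ∈ C) ∧ (y = a ∨ y = b ∨ y ∈ C)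
        symm := ⟨fun x y h => ⟨h.1.symm, h.2.2, h.2.1⟩⟩
        loopless := ⟨fun x h => h.1.ne rfl⟩ }
    refine hG.adj_of_reachable_s1 hab hva hvb (H := H) (C := C) (fun h => h.1.2.1 rfl)
      (fun c hc => hc.1.2.2) (fun x y => Iff.rfl) ?_
    have hCC : ∀ x, Relation.ReflTransGen Q.Adj ca x → H.Reachable ca x := by
      intro x hx
      induction hx with
      | refl => exact Reachable.refl _
      | @tail y z hy hyz ihy =>
        have hy' : y ∈ C :=
          ⟨hyz.2.1, hca.2.trans ((reachable_iff_reflTransGen _ _).2 hy)⟩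
        have hz' : z ∈ C := ⟨hyz.2.2, hy'.2.trans hyz.reachable⟩
        have : H.Adj y z := ⟨hyz.1, Or.inr (Or.inr hy'), Or.inr (Or.inr hz')⟩
        exact ihy.trans this.reachable
    have h1 : H.Adj a ca := ⟨haca, Or.inl rfl, Or.inr (Or.inr hca)⟩
    have h2 : H.Adj cb b := ⟨hbcb.symm, Or.inr (Or.inr hcb), Or.inr (Or.inl rfl)⟩
    exact h1.reachable.trans ((hCC cb ((reachable_iff_reflTransGen _ _).1
      (hca.2.symm.trans hcb.2))).trans h2.reachable)
  have huC : u ∈ C := ⟨⟨hu, huv, hvu⟩, Reachable.refl _⟩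
  let T : Finset V := S.filter fun x => x ∈ C ∨ x ∈ A
  have hTS : T ⊂ S := by
    refine (Finset.ssubset_iff_of_subset (Finset.filter_subset _ _)).2 ⟨v, hv, ?_⟩
    intro h
    rcases (Finset.mem_filter.1 h).2 with h | h
    · exact h.1.2.1 rfl
    · exact h.2.1.ne rfl
  have hCT : ∀ c ∈ C, c ∈ T := fun c hc => Finset.mem_filter.2 ⟨hc.1.1, Or.inl hc⟩
  suffices h : ∃ s ∈ C, G.IsClique {w | w ∈ T ∧ G.Adj s w} by
    obtain ⟨s, hs, hcl⟩ := h
    refine ⟨s, hs.1.1, hs.1.2.1, hs.1.2.2, hcl.subset ?_⟩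
    rintro w ⟨hw, hsw⟩
    exact ⟨Finset.mem_filter.2 ⟨hw, hclosed s hs w hw hsw⟩, hsw⟩
  by_cases hdomA : ∃ a ∈ A, ∃ x ∈ T, x ≠ a ∧ ¬ G.Adj a x
  · obtain ⟨a, ha, hx⟩ := hdomA
    obtain ⟨s, hsT, hsa, has, hcl⟩ :=
      ih T hTS a (Finset.mem_filter.2 ⟨ha.1, Or.inr ha⟩) hx
    rcases (Finset.mem_filter.1 hsT).2 with h | h
    · exact ⟨s, h, hcl⟩
    · exact absurd (hA ha h hsa.symm) has
  · push Not at hdomA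
    by_cases hdomC : ∃ c ∈ C, ∃ x ∈ T, x ≠ c ∧ ¬ G.Adj c x
    · obtain ⟨c, hc, hx⟩ := hdomC
      obtain ⟨s, hsT, hsc, hcs, hcl⟩ := ih T hTS c (hCT c hc) hx
      rcases (Finset.mem_filter.1 hsT).2 with h | h
      · exact ⟨s, h, hcl⟩
      · exact absurd (hdomA s h c (hCT c hc) hsc.symm).symm hcs
    · push Not at hdomC
      refine ⟨u, huC, ?_⟩
      rintro x ⟨hx, -⟩ y ⟨hy, -⟩ hxy
      rcases (Finset.mem_filter.1 hx).2 with h | h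
      · exact hdomC x h y hy hxy.symm
      · exact hdomA x h y hy hxy.symm

/-- Every nonempty set of vertices of a chordal graph has a simplicial vertex. -/
theorem Chordal.exists_simplicial (hG : G.Chordal) {S : Finset V} (hS : S.Nonempty) :
    ∃ s ∈ S, G.IsClique {w | w ∈ S ∧ G.Adj s w} := by
  by_cases h : ∃ v ∈ S, ∃ u ∈ S, u ≠ v ∧ ¬ G.Adj v u
  · obtain ⟨v, hv, hu⟩ := h
    obtain ⟨s, hs, -, -, hcl⟩ := hG.exists_simplicial_not_adj S v hv hu
    exact ⟨s, hs, hcl⟩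
  · push Not at h
    obtain ⟨s, hs⟩ := hS
    exact ⟨s, hs, fun x hx y hy hxy => h x hx.1 y hy.1 hxy.symm⟩

end SimpleGraph

namespace SimpleGraph
variable {V : Type*} {G : SimpleGraph V}

theorem card_edgeSet_induce_eq_card_filter [Fintype V] (G : SimpleGraph V) (W : Finset V) :
    Nat.card (G.induce (W : Set V)).edgeSet =
      #{e : Sym2 V | e ∈ G.edgeSet ∧ ∀ v ∈ e, v ∈ W} := by
  have h := congrArg Finset.card (map_edgeFinset_induce (s := (W : Set V)) (G := G))
  rw [Finset.card_map] at h
  rw [Nat.card_eq_fintype_card, ← edgeFinset_card]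
  refine Eq.trans ?_ (h.trans ?_)
  · congr!
  · congr 1
    ext e
    simp [Finset.mem_sym2_iff]

theorem isInducedTree_iff [Fintype V] {W : Finset V} :
    G.IsInducedTree W ↔ (G.induce (W : Set V)).Connected ∧
      #{e : Sym2 V | e ∈ G.edgeSet ∧ ∀ v ∈ e, v ∈ W} + 1 = #W := by
  rw [IsInducedTree, isTree_iff_connected_and_card, card_edgeSet_induce_eq_card_filter]
  simp

theorem isInducedTree_singleton (G : SimpleGraph V) (v : V) : G.IsInducedTree {v} := by
  rw [IsInducedTree, Finset.coe_singleton]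
  exact IsTree.of_subsingleton

/-- Adding a vertex with exactly one neighbor to an induced tree gives an induced tree. -/
theorem IsInducedTree.insert [Fintype V] {W : Finset V} (hW : G.IsInducedTree W) {u v : V}
    (hv : v ∉ W) (hN : ∀ w, w ∈ W ∧ G.Adj v w ↔ w = u) : G.IsInducedTree (insert v W) := by
  rw [isInducedTree_iff] at hW ⊢
  obtain ⟨huW, hvu⟩ := (hN u).2 rfl
  constructor
  · have := connected_induce_union (s := {v}) (t := (W : Set V))
      Preconnected.of_subsingleton
      hW.1.preconnected (Set.mem_singleton v) huW hvu
    rwa [Finset.coe_insert, Set.insert_eq]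
  · have h : ({e : Sym2 V | e ∈ G.edgeSet ∧ ∀ x ∈ e, x ∈ Insert.insert v W} : Finset (Sym2 V)) =
        Insert.insert s(v, u) ({e : Sym2 V | e ∈ G.edgeSet ∧ ∀ x ∈ e, x ∈ W} : Finset _) := by
      ext e
      induction e using Sym2.ind with
      | _ a b =>
        simp only [Finset.mem_filter, Finset.mem_univ, true_and, mem_edgeSet, Sym2.mem_iff,
          forall_eq_or_imp, forall_eq, Finset.mem_insert, Sym2.eq_iff]
        constructor
        · rintro ⟨hab, rfl | ha, rfl | hb⟩
          · exact absurd hab (G.irrefl)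
          · exact Or.inl (Or.inl ⟨rfl, (hN b).1 ⟨hb, hab⟩⟩)
          · exact Or.inl (Or.inr ⟨(hN a).1 ⟨ha, hab.symm⟩, rfl⟩)
          · exact Or.inr ⟨hab, ha, hb⟩
        · rintro ((⟨rfl, rfl⟩ | ⟨rfl, rfl⟩) | ⟨hab, ha, hb⟩)
          · exact ⟨hvu, Or.inl rfl, Or.inr huW⟩
          · exact ⟨hvu.symm, Or.inr huW, Or.inl rfl⟩
          · exact ⟨hab, Or.inr ha, Or.inr hb⟩
    rw [h, Finset.card_insert_of_notMem, Finset.card_insert_of_notMem hv, ← hW.2]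
    simp [hv]

theorem IsInducedTree.not_triangle {W : Finset V} (hW : G.IsInducedTree W) {a b c : V}
    (ha : a ∈ W) (hb : b ∈ W) (hc : c ∈ W) (hab : G.Adj a b) (hac : G.Adj a c) :
    ¬ G.Adj b c := by
  intro hbc
  refine hW.isAcyclic.cliqueFree le_rfl {⟨a, ha⟩, ⟨b, hb⟩, ⟨c, hc⟩} ?_
  rw [is3Clique_triple_iff]
  exact ⟨hab, hac, hbc⟩

theorem IsInducedTree.sum_xi_le {W : Finset V} (hW : G.IsInducedTree W) {K : Finset V}
    (hK : G.IsClique (K : Set V)) {v : V} (hv : v ∈ K) :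
    ∑ u ∈ K.erase v, (G.xi W).2 s(u, v) ≤ (G.xi W).1 v := by
  by_cases h : ∃ u ∈ K.erase v, u ∈ W ∧ v ∈ W
  · obtain ⟨u, hu, huW, hvW⟩ := h
    rw [Finset.sum_eq_single_of_mem u hu]
    · simp only [xi]
      split_ifs <;> simp
    · intro w hw hwu
      simp only [xi, mem_edgeSet, Sym2.mem_iff, forall_eq_or_imp, forall_eq]
      rw [if_neg]
      rintro ⟨-, hwW, -⟩
      have hw' := Finset.mem_erase.1 hw
      have hu' := Finset.mem_erase.1 hu
      exact hW.not_triangle hvW huW hwW (hK hv hu'.2 hu'.1.symm) (hK hv hw'.2 hw'.1.symm)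
        (hK hu'.2 hw'.2 hwu.symm)
  · rw [Finset.sum_eq_zero]
    · simp only [xi]
      split_ifs <;> simp
    · intro u hu
      simp only [xi, mem_edgeSet, Sym2.mem_iff, forall_eq_or_imp, forall_eq]
      rw [if_neg]
      rintro ⟨-, h'⟩
      exact h ⟨u, hu, h'⟩

theorem IsInducedTree.sum_xi_sub_sum_xi [Fintype V] {W : Finset V} (hW : G.IsInducedTree W) :
    ∑ v, (G.xi W).1 v - ∑ e, (G.xi W).2 e = 1 := by
  have h := (isInducedTree_iff.1 hW).2
  have h1 : ∑ v, (G.xi W).1 v = #W := by simp [xi]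
  have h2 : ∑ e, (G.xi W).2 e = #{e : Sym2 V | e ∈ G.edgeSet ∧ ∀ v ∈ e, v ∈ W} := by
    rw [Finset.card_filter]
    push_cast
    exact Finset.sum_congr rfl fun e _ => by simp only [xi]; congr
  rw [h1, h2, ← h]
  push_cast
  ring

theorem inducedTreePolytope_subset [Fintype V] (G : SimpleGraph V) : G.inducedTreePolytope ⊆
    {p | (∀ v, 0 ≤ p.1 v) ∧ (∀ e, 0 ≤ p.2 e) ∧ (∀ e ∉ G.edgeSet, p.2 e = 0) ∧
      (∀ (K : Finset V), G.IsClique (K : Set V) → ∀ v ∈ K,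
        ∑ u ∈ K.erase v, p.2 s(u, v) ≤ p.1 v) ∧
      ∑ v, p.1 v - ∑ e, p.2 e = 1} := by
  refine convexHull_min ?_ ?_
  · rintro p ⟨W, hW, rfl⟩
    refine ⟨fun v => ?_, fun e => ?_, fun e he => ?_, fun K hK v hv => hW.sum_xi_le hK hv,
      hW.sum_xi_sub_sum_xi⟩
    · simp only [xi]; split_ifs <;> simp
    · simp only [xi]; split_ifs <;> simp
    · simp [xi, he]
  · rintro p ⟨h1, h2, h3, h4, h5⟩ q ⟨g1, g2, g3, g4, g5⟩ a b ha hb hab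
    refine ⟨fun v => ?_, fun e => ?_, fun e he => ?_, fun K hK v hv => ?_, ?_⟩
    · have := h1 v; have := g1 v
      simp only [Prod.fst_add, Prod.smul_fst, Pi.add_apply, Pi.smul_apply, smul_eq_mul]
      positivity
    · have := h2 e; have := g2 e
      simp only [Prod.snd_add, Prod.smul_snd, Pi.add_apply, Pi.smul_apply, smul_eq_mul]
      positivity
    · simp [h3 e he, g3 e he]
    · simp only [Prod.snd_add, Prod.smul_snd, Prod.fst_add, Prod.smul_fst, Pi.add_apply,
        Pi.smul_apply, smul_eq_mul, Finset.sum_add_distrib, ← Finset.mul_sum]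
      gcongr
      exacts [h4 K hK v hv, g4 K hK v hv]
    · simp only [Prod.snd_add, Prod.smul_snd, Prod.fst_add, Prod.smul_fst, Pi.add_apply,
        Pi.smul_apply, smul_eq_mul, Finset.sum_add_distrib, ← Finset.mul_sum]
      linear_combination a * h5 + b * g5 + hab

theorem fst_sum_xi_apply (G : SimpleGraph V) (M : Multiset (Finset V)) (v : V) :
    (M.map G.xi).sum.1 v = M.countP (v ∈ ·) := by
  induction M using Multiset.induction with
  | empty => simp
  | cons W M ih =>
    simp only [Multiset.map_cons, Multiset.sum_cons, Prod.fst_add, Pi.add_apply, ih,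
      Multiset.countP_cons, xi]
    push_cast
    rw [add_comm]

theorem snd_sum_xi_apply (G : SimpleGraph V) (M : Multiset (Finset V)) {a b : V}
    (hab : G.Adj a b) :
    (M.map G.xi).sum.2 s(a, b) = M.countP fun W => a ∈ W ∧ b ∈ W := by
  induction M using Multiset.induction with
  | empty => simp
  | cons W M ih =>
    simp only [Multiset.map_cons, Multiset.sum_cons, Prod.snd_add, Pi.add_apply, ih,
      Multiset.countP_cons, xi, mem_edgeSet, hab, true_and, Sym2.mem_iff, forall_eq_or_imp,
      forall_eq]
    push_cast
    rw [add_comm]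

theorem snd_sum_xi_apply_of_notMem (G : SimpleGraph V) (M : Multiset (Finset V)) {e : Sym2 V}
    (he : e ∉ G.edgeSet) : (M.map G.xi).sum.2 e = 0 := by
  induction M using Multiset.induction with
  | empty => simp
  | cons W M ih => simp [ih, xi, he]

theorem sum_fst_sub_sum_snd_sum_xi [Fintype V] {M : Multiset (Finset V)}
    (hM : ∀ W ∈ M, G.IsInducedTree W) :
    ∑ v, (M.map G.xi).sum.1 v - ∑ e, (M.map G.xi).sum.2 e = Multiset.card M := by
  induction M using Multiset.induction with
  | empty => simp
  | cons W M ih =>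
    have h1 := ih fun W' h => hM W' (Multiset.mem_cons_of_mem h)
    have h2 := (hM W (Multiset.mem_cons_self W M)).sum_xi_sub_sum_xi
    simp only [Multiset.map_cons, Multiset.sum_cons, Prod.fst_add, Prod.snd_add, Pi.add_apply,
      Finset.sum_add_distrib, Multiset.card_cons]
    push_cast
    linarith

end SimpleGraph

theorem Multiset.exists_le_countP_eq {α ι : Type*} (M : Multiset α) (N : Finset ι)
    (P : ι → α → Prop) (hP : ∀ a i j, P i a → P j a → i = j) (c : ι → ℕ)
    (hc : ∀ i ∈ N, c i ≤ M.countP (P i)) :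
    ∃ T ≤ M, (∀ i ∈ N, T.countP (P i) = c i) ∧ T.card = ∑ i ∈ N, c i ∧
      ∀ a ∈ T, ∃ i ∈ N, P i a := by
  suffices h : ∃ T ≤ M.filter (fun a => ∃ i ∈ N, P i a), (∀ i ∈ N, T.countP (P i) = c i) ∧
      T.card = ∑ i ∈ N, c i by
    obtain ⟨T, hT, h1, h2⟩ := h
    exact ⟨T, hT.trans (Multiset.filter_le _ _), h1, h2,
      fun a ha => (Multiset.mem_filter.1 (Multiset.mem_of_le hT ha)).2⟩
  induction N using Finset.induction with
  | empty => exact ⟨0, Multiset.zero_le _, by simp, by simp⟩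
  | insert j N hj ih =>
    obtain ⟨T, hT, h1, h2⟩ := ih fun i hi => hc i (Finset.mem_insert_of_mem hi)
    have hcj := hc j (Finset.mem_insert_self j N)
    rw [Multiset.countP_eq_card_filter] at hcj
    obtain ⟨R, hR, hRc⟩ : ∃ R ≤ M.filter (P j), R.card = c j := by
      obtain ⟨R, hR⟩ := Multiset.card_pos_iff_exists_mem.1
        (by rw [Multiset.card_powersetCard]; exact Nat.choose_pos hcj :
          0 < (Multiset.powersetCard (c j) (M.filter (P j))).card)
      exact ⟨R, Multiset.mem_powersetCard.1 hR⟩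
    have hRP : ∀ a ∈ R, P j a := fun a ha => (Multiset.mem_filter.1 (Multiset.mem_of_le hR ha)).2
    have hTP : ∀ a ∈ T, ∃ i ∈ N, P i a :=
      fun a ha => (Multiset.mem_filter.1 (Multiset.mem_of_le hT ha)).2
    refine ⟨R + T, ?_, ?_, ?_⟩
    · refine (add_le_add hR hT).trans ?_
      rw [Multiset.filter_add_filter, Multiset.filter_eq_nil (p := fun a => P j a ∧ _) |>.2]
      · simp
      · rintro a - ⟨h, i, hi, hia⟩
        exact hj (hP a j i h hia ▸ hi)
    · intro i hi
      rw [Multiset.countP_add]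
      rcases Finset.mem_insert.1 hi with rfl | hi
      · rw [Multiset.countP_eq_card.2 hRP, Multiset.countP_eq_zero.2, hRc, add_zero]
        intro a ha h
        obtain ⟨l, hl, hla⟩ := hTP a ha
        exact hj (hP a i l h hla ▸ hl)
      · rw [h1 i hi, Multiset.countP_eq_zero.2, zero_add]
        intro a ha h
        exact hj (hP a j i (hRP a ha) h ▸ hi)
    · rw [Multiset.card_add, hRc, h2, Finset.sum_insert hj]

theorem Multiset.countP_mem_le_countP_inter_add_sum {V : Type*} (M : Multiset (Finset V))
    (N : Finset V) {u : V} (hu : u ∈ N) :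
    M.countP (u ∈ ·) ≤ M.countP (fun W => ∀ w, w ∈ W ∧ w ∈ N ↔ w = u) +
      ∑ w ∈ N.erase u, M.countP fun W => w ∈ W ∧ u ∈ W := by
  induction M using Multiset.induction with
  | empty => simp
  | cons W M ih =>
    simp only [Multiset.countP_cons, Finset.sum_add_distrib]
    suffices h : (if u ∈ W then 1 else 0) ≤ (if ∀ w, w ∈ W ∧ w ∈ N ↔ w = u then 1 else 0) +
        ∑ w ∈ N.erase u, (if w ∈ W ∧ u ∈ W then 1 else 0) by omega
    by_cases huW : u ∈ W
    · by_cases h : ∃ w ∈ N.erase u, w ∈ W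
      · obtain ⟨w, hw, hwW⟩ := h
        have := Finset.single_le_sum (f := fun w => if w ∈ W ∧ u ∈ W then 1 else 0)
          (fun _ _ => Nat.zero_le _) hw
        simp only [hwW, huW, and_self, if_true] at this ⊢
        omega
      · rw [if_pos huW, if_pos]
        · omega
        · intro w
          constructor
          · rintro ⟨hw, hwN⟩
            by_contra hwu
            exact h ⟨w, Finset.mem_erase.2 ⟨hwu, hwN⟩, hw⟩
          · rintro rfl
            exact ⟨huW, hu⟩
    · simp [huW]

theorem Multiset.countP_congr_iff {α : Type*} {p q : α → Prop} {_ : DecidablePred p}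
    {_ : DecidablePred q} {s : Multiset α} (h : ∀ a ∈ s, p a ↔ q a) :
    s.countP p = s.countP q :=
  Multiset.countP_congr rfl fun a ha => propext (h a ha)

theorem Multiset.countP_add_map_add_replicate {α : Type*} {R T : Multiset α} (f : α → α)
    (n : ℕ) (a : α) (p : α → Prop) [DecidablePred p] :
    (R + T.map f + Multiset.replicate n a).countP p =
      R.countP p + T.countP (fun b => p (f b)) + if p a then n else 0 := by
  rw [Multiset.countP_add, Multiset.countP_add, Multiset.countP_map,
    ← Multiset.countP_eq_card_filter]
  congr 1
  split_ifs with h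
  · rw [Multiset.countP_eq_card.2, Multiset.card_replicate]
    exact fun b hb => Multiset.eq_of_mem_replicate hb ▸ h
  · rw [Multiset.countP_eq_zero.2]
    exact fun b hb => Multiset.eq_of_mem_replicate hb ▸ h

namespace SimpleGraph
variable {V : Type*} {G : SimpleGraph V}

/-- A nonnegative integer vector satisfying all clique inequalities of a chordal graph is a sum of
extended incidence vectors of induced trees. -/
theorem Chordal.exists_multiset_isInducedTree [Fintype V] (hG : G.Chordal) (S : Finset V) :
    ∀ (x : V → ℕ) (y : Sym2 V → ℕ), (∀ v ∉ S, x v = 0) →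
      (∀ a b, G.Adj a b → a ∉ S → y s(a, b) = 0) →
      (∀ (K : Finset V), G.IsClique (K : Set V) → ∀ v ∈ K,
        ∑ u ∈ K.erase v, y s(u, v) ≤ x v) →
      ∃ M : Multiset (Finset V), (∀ W ∈ M, G.IsInducedTree W ∧ W ⊆ S) ∧
        (∀ v, M.countP (v ∈ ·) = x v) ∧
        ∀ a b, G.Adj a b → M.countP (fun W => a ∈ W ∧ b ∈ W) = y s(a, b) := by
  induction S using Finset.strongInduction with
  | H S ih =>
  intro x y hx hy hK
  rcases S.eq_empty_or_nonempty with rfl | hS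
  · refine ⟨0, by simp, fun v => by simp [hx v], fun a b hab => ?_⟩
    simp [hy a b hab (Finset.notMem_empty a)]
  obtain ⟨v, hvS, hv⟩ := hG.exists_simplicial hS
  let N : Finset V := S.filter (G.Adj v)
  have hN : ∀ w, w ∈ N ↔ w ∈ S ∧ G.Adj v w := fun w => Finset.mem_filter
  have hNcl : G.IsClique (N : Set V) := hv.subset fun w hw => (hN w).1 hw
  have hvN : v ∉ N := fun h => ((hN v).1 h).2.ne rfl
  have hvNcl : G.IsClique ((insert v N : Finset V) : Set V) := by
    rw [Finset.coe_insert]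
    exact hNcl.insert fun w hw _ => ((hN w).1 hw).2
  let x' : V → ℕ := fun w => if w = v then 0 else x w
  let y' : Sym2 V → ℕ := fun e => if v ∈ e then 0 else y e
  obtain ⟨M, hM, hMx, hMy⟩ := ih (S.erase v) (Finset.erase_ssubset hvS) x' y'
    (by
      intro w hw
      by_cases h : w = v
      · simp [x', h]
      · simpa [x', h] using hx w fun hwS => hw (Finset.mem_erase.2 ⟨h, hwS⟩))
    (by
      intro a b hab ha
      by_cases h : a = v
      · simp [y', h]
      · simp only [y']
        split_ifs
        · rfl
        · exact hy a b hab fun haS => ha (Finset.mem_erase.2 ⟨h, haS⟩))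
    (by
      intro K hKc w hw
      by_cases h : w = v
      · simp [x', y', h]
      · simp only [x', if_neg h]
        refine le_trans (Finset.sum_le_sum fun u _ => ?_) (hK K hKc w hw)
        simp only [y']
        split_ifs
        · exact Nat.zero_le _
        · exact le_rfl)
  have hvM : ∀ W ∈ M, v ∉ W := fun W hW h => Finset.notMem_erase v S ((hM W hW).2 h)
  obtain ⟨T, hTM, hTc, hTcard, hTP⟩ := M.exists_le_countP_eq N
    (fun u W => ∀ w, w ∈ W ∧ w ∈ N ↔ w = u)
    (fun W i j hi hj => (hj i).1 ((hi i).2 rfl)) (fun u => y s(u, v))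
    (by
      intro u hu
      have huv : u ≠ v := fun h => hvN (h ▸ hu)
      have h1 := M.countP_mem_le_countP_inter_add_sum N hu
      have h2 := hK _ hvNcl u (Finset.mem_insert_of_mem hu)
      rw [Finset.erase_insert_of_ne huv.symm,
        Finset.sum_insert (fun h => hvN (Finset.mem_of_mem_erase h))] at h2
      have h3 : ∑ w ∈ N.erase u, M.countP (fun W => w ∈ W ∧ u ∈ W) =
          ∑ w ∈ N.erase u, y s(w, u) := by
        refine Finset.sum_congr rfl fun w hw => ?_
        obtain ⟨hwu, hwN⟩ := Finset.mem_erase.1 hw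
        have hwv : w ≠ v := fun h => hvN (h ▸ hwN)
        rw [hMy w u (hNcl hwN hu hwu)]
        simp [y', hwv.symm, huv.symm]
      rw [h3, hMx u] at h1
      simp only [x', if_neg huv] at h1
      rw [Sym2.eq_swap] at h2
      omega)
  have hTM' : ∀ W ∈ T, W ∈ M := fun W hW => Multiset.mem_of_le hTM hW
  have hvx := hK _ hvNcl v (Finset.mem_insert_self v N)
  rw [Finset.erase_insert hvN, ← hTcard] at hvx
  have hvMT : ∀ W ∈ M - T, v ∉ W := fun W hW => hvM W (Multiset.mem_of_le tsub_le_self hW)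
  have hcount : ∀ (p : Finset V → Prop) [DecidablePred p], ¬ p {v} →
      (∀ W ∈ T, p (insert v W) ↔ p W) →
      ((M - T) + T.map (insert v) + Multiset.replicate (x v - T.card) {v}).countP p =
        M.countP p := by
    intro p _ hp1 hp2
    rw [Multiset.countP_add_map_add_replicate, if_neg hp1, add_zero,
      Multiset.countP_congr_iff hp2, ← Multiset.countP_add, tsub_add_cancel_of_le hTM]
  have hTb : ∀ b, G.Adj v b → T.countP (b ∈ ·) = y s(v, b) := by
    intro b hb
    rw [Sym2.eq_swap]
    by_cases hbS : b ∈ S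
    · have hbN : b ∈ N := (hN b).2 ⟨hbS, hb⟩
      refine (Multiset.countP_congr_iff fun W hW => ?_).trans (hTc b hbN)
      constructor
      · intro hbW
        obtain ⟨u, hu, huW⟩ := hTP W hW
        rwa [(huW b).1 ⟨hbW, hbN⟩]
      · intro h
        exact ((h b).2 rfl).1
    · rw [hy b v hb.symm hbS, Multiset.countP_eq_zero]
      exact fun W hW hbW => hbS (Finset.mem_of_mem_erase ((hM W (hTM' W hW)).2 hbW))
  have hadj : ∀ b, G.Adj v b →
      ((M - T) + T.map (insert v) + Multiset.replicate (x v - T.card) {v}).countP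
        (fun W => v ∈ W ∧ b ∈ W) = y s(v, b) := by
    intro b hb
    rw [Multiset.countP_add_map_add_replicate, if_neg (by simp [hb.ne.symm]), add_zero,
      Multiset.countP_eq_zero.2 fun W hW h => hvMT W hW h.1, zero_add, ← hTb b hb]
    exact Multiset.countP_congr_iff fun W _ => by simp [hb.ne.symm]
  refine ⟨(M - T) + T.map (insert v) + Multiset.replicate (x v - T.card) {v}, ?_, ?_, ?_⟩
  · intro W hW
    rw [Multiset.mem_add, Multiset.mem_add, Multiset.mem_map] at hW
    rcases hW with (hW | ⟨W, hW, rfl⟩) | hW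
    · have := hM W (Multiset.mem_of_le tsub_le_self hW)
      exact ⟨this.1, this.2.trans (Finset.erase_subset _ _)⟩
    · obtain ⟨hWt, hWS⟩ := hM W (hTM' W hW)
      obtain ⟨u, hu, huW⟩ := hTP W hW
      have hWS' : W ⊆ S := hWS.trans (Finset.erase_subset _ _)
      refine ⟨hWt.insert (u := u) (hvM W (hTM' W hW)) fun w => ?_,
        Finset.insert_subset hvS hWS'⟩
      rw [← huW w, hN]
      exact ⟨fun h => ⟨h.1, hWS' h.1, h.2⟩, fun h => ⟨h.1, h.2.2⟩⟩
    · rw [Multiset.eq_of_mem_replicate hW]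
      exact ⟨G.isInducedTree_singleton v, Finset.singleton_subset_iff.2 hvS⟩
  · intro w
    by_cases hwv : w = v
    · subst hwv
      rw [Multiset.countP_add_map_add_replicate, if_pos (Finset.mem_singleton_self w),
        Multiset.countP_eq_zero.2 hvMT,
        Multiset.countP_eq_card.2 fun W _ => Finset.mem_insert_self w W]
      omega
    · rw [hcount (w ∈ ·) (by simp [hwv]) (fun W _ => by simp [hwv]), hMx]
      simp [x', hwv]
  · intro a b hab
    by_cases hav : a = v
    · subst hav
      exact hadj b hab
    · by_cases hbv : b = v
      · subst hbv
        rw [Sym2.eq_swap, ← hadj a hab.symm]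
        exact Multiset.countP_congr_iff fun W _ => and_comm
      · rw [hcount (fun W => a ∈ W ∧ b ∈ W) (by simp [hav]) (fun W _ => by simp [hav, hbv]), hMy a b hab]
        simp [y', Ne.symm hav, Ne.symm hbv]

end SimpleGraph

open scoped Pointwise in
/-- the induced tree polytope of a chordal graph has the integer
decomposition property. -/
theorem inducedTreePolytope_IDP {V : Type*} [Fintype V]
    (G : SimpleGraph V) (hG : G.Chordal) (k : ℕ) (hk : 0 < k)
    (q : (V → ℝ) × (Sym2 V → ℝ)) (hq : q ∈ (k : ℝ) • G.inducedTreePolytope)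
    (hx : ∀ v, ∃ n : ℤ, q.1 v = n) (hy : ∀ e, ∃ n : ℤ, q.2 e = n) :
    ∃ f : Fin k → Finset V, (∀ i, G.IsInducedTree (f i)) ∧ q = ∑ i, G.xi (f i) := by
  obtain ⟨p, hp, rfl⟩ := hq
  obtain ⟨hp1, hp2, hp3, hp4, hp5⟩ := G.inducedTreePolytope_subset hp
  have hk0 : (0 : ℝ) ≤ k := Nat.cast_nonneg k
  have hx' : ∀ v, ∃ n : ℕ, ((k : ℝ) • p).1 v = n := by
    intro v
    obtain ⟨n, hn⟩ := hx v
    have h0 : 0 ≤ ((k : ℝ) • p).1 v := mul_nonneg hk0 (hp1 v)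
    lift n to ℕ using by rw [hn] at h0; exact_mod_cast h0
    exact ⟨n, by simpa using hn⟩
  have hy' : ∀ e, ∃ n : ℕ, ((k : ℝ) • p).2 e = n := by
    intro e
    obtain ⟨n, hn⟩ := hy e
    have h0 : 0 ≤ ((k : ℝ) • p).2 e := mul_nonneg hk0 (hp2 e)
    lift n to ℕ using by rw [hn] at h0; exact_mod_cast h0
    exact ⟨n, by simpa using hn⟩
  choose x hx using hx'
  choose y hy using hy'
  obtain ⟨M, hM, hMx, hMy⟩ := hG.exists_multiset_isInducedTree Finset.univ x y
    (fun v hv => absurd (Finset.mem_univ v) hv)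
    (fun a b _ ha => absurd (Finset.mem_univ a) ha)
    (by
      intro K hK v hv
      have h := mul_le_mul_of_nonneg_left (hp4 K hK v hv) hk0
      rw [Finset.mul_sum] at h
      have h' : ∑ u ∈ K.erase v, (y s(u, v) : ℝ) ≤ x v := by
        rw [← hx]
        simp only [← hy]
        exact h
      exact_mod_cast h')
  have hsum : (M.map G.xi).sum = (k : ℝ) • p := by
    refine Prod.ext (funext fun v => ?_) (funext fun e => ?_)
    · rw [G.fst_sum_xi_apply, hMx, hx]
    · by_cases he : e ∈ G.edgeSet
      · induction e using Sym2.ind with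
        | _ a b => rw [G.snd_sum_xi_apply M he, hMy a b he, hy]
      · rw [G.snd_sum_xi_apply_of_notMem M he]
        simp [hp3 e he]
  have hcard : Multiset.card M = k := by
    have h := sum_fst_sub_sum_snd_sum_xi fun W hW => (hM W hW).1
    rw [hsum] at h
    simp only [Prod.smul_fst, Prod.smul_snd, Pi.smul_apply, smul_eq_mul, ← Finset.mul_sum,
      ← mul_sub, hp5, mul_one] at h
    exact_mod_cast h.symm
  induction M using Quotient.inductionOn with
  | _ l =>
    obtain rfl : l.length = k := hcard
    refine ⟨fun i => l[i], fun i => (hM _ (List.getElem_mem i.2)).1, ?_⟩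
    exact hsum.symm.trans (Fin.sum_univ_fun_getElem l G.xi).symm
end

section
/- Let G be a finite simple chordal graph. Then T(G) is contained in the unit cube: every (x,y) ∈ T(G) satisfies 0 ≤ x_v ≤ 1 for every vertex v and 0 ≤ y_e ≤ 1 for every edge e. (In particular, for each vertex v, summing the inequalities of C_T(G) arising from a perfect elimination ordering of G ending in v with the hyperplane equation yields x_v ≤ 1.) -/
open SimpleGraph Finset
open scoped Classical

theorem SimpleGraph.Walk.le_succ_of_adj_getVert_of_length_eq_dist {V : Type*}
    {G : SimpleGraph V} {a b : V} (p : G.Walk a b) (hp : p.length = G.dist a b) {i j : ℕ}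
    (hj : j ≤ p.length) (h : G.Adj (p.getVert i) (p.getVert j)) : j ≤ i + 1 := by
  have := dist_le ((p.take i).append (.cons h (p.drop j)))
  simp only [Walk.length_append, Walk.length_cons, Walk.take_length, Walk.drop_length] at this
  omega

theorem SimpleGraph.Walk.getVert_adj_getVert_iff_of_length_eq_dist {V : Type*}
    {G : SimpleGraph V} {a b : V} (p : G.Walk a b) (hp : p.length = G.dist a b) {i j : ℕ}
    (hi : i ≤ p.length) (hj : j ≤ p.length) :
    G.Adj (p.getVert i) (p.getVert j) ↔ j = i + 1 ∨ i = j + 1 := by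
  constructor
  · intro h
    have h₁ := p.le_succ_of_adj_getVert_of_length_eq_dist hp hj h
    have h₂ := p.le_succ_of_adj_getVert_of_length_eq_dist hp hi h.symm
    have h₃ : i ≠ j := fun e => G.loopless.irrefl _ (e ▸ h)
    omega
  · rintro (rfl | rfl)
    · exact p.adj_getVert_succ (by omega)
    · exact (p.adj_getVert_succ (by omega)).symm

theorem Fin.val_sub_eq_one_iff {n : ℕ} (hn : 2 ≤ n) (a b : Fin n) :
    (a - b).val = 1 ↔ a.val = b.val + 1 ∨ a.val = 0 ∧ b.val + 1 = n := by
  rcases le_or_gt b a with h | h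
  · rw [Fin.sub_val_of_le h]
    have : b.val ≤ a.val := h
    omega
  · rw [Fin.coe_sub_iff_lt.2 h]
    have : a.val < b.val := h
    omega

/-- In a chordal graph, two neighbours of `v` that are joined by a walk whose inner vertices avoid
the closed neighbourhood of `v` are adjacent. -/
theorem SimpleGraph.Chordal.adj_of_reachable_induce {V : Type*} {G : SimpleGraph V}
    (hG : G.Chordal) {T : Set V} {v b₁ b₂ : V} (hv : ∀ t ∈ T, t ≠ v ∧ ¬ G.Adj v t)
    (hb₁ : G.Adj v b₁) (hb₂ : G.Adj v b₂) (hne : b₁ ≠ b₂) {c₁ c₂ : T} (h₁ : G.Adj b₁ c₁)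
    (h₂ : G.Adj b₂ c₂) (hr : (G.induce T).Reachable c₁ c₂) : G.Adj b₁ b₂ := by
  by_contra hnadj
  let X : Set V := insert b₁ (insert b₂ T)
  have hTX : T ⊆ X := fun t ht => Or.inr (Or.inr ht)
  let B₁ : X := ⟨b₁, Or.inl rfl⟩
  let B₂ : X := ⟨b₂, Or.inr (Or.inl rfl)⟩
  have hreach : (G.induce X).Reachable B₁ B₂ := by
    have e₁ : (G.induce X).Adj B₁ ⟨c₁, hTX c₁.2⟩ := h₁
    have e₂ : (G.induce X).Adj ⟨c₂, hTX c₂.2⟩ B₂ := h₂.symm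
    exact e₁.reachable.trans ((hr.map (G.induceHomOfLE hTX).toHom).trans e₂.reachable)
  obtain ⟨p, hp⟩ := hreach.exists_walk_length_eq_dist
  have hpath := p.isPath_of_length_eq_dist hp
  have hadj := fun i j hi hj =>
    p.getVert_adj_getVert_iff_of_length_eq_dist hp (i := i) (j := j) hi hj
  have hd : 2 ≤ p.length := by
    by_contra! hlt
    have hcases : p.length = 0 ∨ p.length = 1 := by omega
    rcases hcases with h | h
    · exact hne (congrArg Subtype.val (Walk.eq_of_length_eq_zero h))
    · have e : (G.induce X).Adj B₁ B₂ := p.adj_of_length_eq_one h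
      exact hnadj e
  have hinner : ∀ i, 0 < i → i < p.length → (p.getVert i : V) ∈ T := by
    intro i hi hi'
    rcases (p.getVert i).2 with h | h | h
    · have : i = 0 := hpath.getVert_injOn hi'.le (Nat.zero_le _)
        ((Subtype.ext h).trans p.getVert_zero.symm)
      omega
    · have : i = p.length := hpath.getVert_injOn hi'.le (le_refl p.length)
        ((Subtype.ext h).trans p.getVert_length.symm)
      omega
    · exact h
  have hv_adj : ∀ i ≤ p.length, G.Adj v (p.getVert i) ↔ i = 0 ∨ i = p.length := by
    intro i hi
    constructor
    · intro h
      by_contra! hne'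
      exact (hv _ (hinner i (by omega) (by omega))).2 h
    · rintro (rfl | rfl)
      · simpa [B₁] using hb₁
      · simpa [B₂] using hb₂
  have hv_ne : ∀ i ≤ p.length, (p.getVert i : V) ≠ v := by
    intro i hi h
    by_cases hi' : i = 0 ∨ i = p.length
    · exact ((hv_adj i hi).2 hi').ne h.symm
    · exact (hv _ (hinner i (by omega) (by omega))).1 h
  let f : Fin (p.length + 2) → V := fun i => if i.val ≤ p.length then p.getVert i else v
  have hf : Function.Injective f := by
    intro i j hij
    simp only [f] at hij
    split_ifs at hij with hi hj hj
    · exact Fin.ext (hpath.getVert_injOn hi hj (Subtype.ext hij))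
    · exact (hv_ne _ hi hij).elim
    · exact (hv_ne _ hj hij.symm).elim
    · omega
  refine hG ⟨Set.range f, p.length + 2, by omega,
    ⟨RelIso.symm ⟨Equiv.ofInjective f hf, fun {i j} => ?_⟩⟩⟩
  change G.Adj (f i) (f j) ↔ _
  rw [cycleGraph_adj', Fin.val_sub_eq_one_iff (by omega), Fin.val_sub_eq_one_iff (by omega)]
  simp only [f]
  split_ifs with hi hj hj
  · exact (hadj i j hi hj).trans (by omega)
  · rw [G.adj_comm, hv_adj _ hi]
    omega
  · rw [hv_adj _ hj]
    omega
  · simp only [G.irrefl, false_iff]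
    omega

/-- Dirac's lemma, inside a vertex set `S`: a vertex of `S` that is not adjacent to all the others
has a non-neighbour in `S` whose neighbourhood in `S` is a clique. -/
theorem SimpleGraph.Chordal.exists_simplicial_of_not_adj {V : Type*} {G : SimpleGraph V}
    (hG : G.Chordal) (S : Finset V) {v c₀ : V} (hvS : v ∈ S) (hc₀S : c₀ ∈ S) (hc₀ : c₀ ≠ v)
    (hvc₀ : ¬ G.Adj v c₀) :
    ∃ u ∈ S, u ≠ v ∧ ¬ G.Adj v u ∧ G.IsClique {w | w ∈ S ∧ G.Adj u w} := by
  induction S using Finset.strongInduction generalizing v c₀ with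
  | H S ih =>
  let T : Set V := {t | t ∈ S ∧ t ≠ v ∧ ¬ G.Adj v t}
  let C : Set V := {c | ∃ h : c ∈ T, (G.induce T).Reachable ⟨c₀, hc₀S, hc₀, hvc₀⟩ ⟨c, h⟩}
  let B : Set V := {b | b ∈ S ∧ G.Adj v b ∧ ∃ c ∈ C, G.Adj b c}
  have hc₀C : c₀ ∈ C := ⟨⟨hc₀S, hc₀, hvc₀⟩, .rfl⟩
  have hB : G.IsClique B := by
    rintro b₁ ⟨-, hb₁, c₁, ⟨hc₁, hr₁⟩, h₁⟩ b₂ ⟨-, hb₂, c₂, ⟨hc₂, hr₂⟩, h₂⟩ hne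
    exact hG.adj_of_reachable_induce (T := T) (fun t ht => ht.2) hb₁ hb₂ hne
      (c₁ := ⟨c₁, hc₁⟩) (c₂ := ⟨c₂, hc₂⟩) h₁ h₂ (hr₁.symm.trans hr₂)
  have hnbr : ∀ c ∈ C, ∀ w ∈ S, G.Adj c w → w ∈ C ∨ w ∈ B := by
    rintro c hcC w hw hcw
    obtain ⟨hc, hr⟩ := hcC
    by_cases hvw : G.Adj v w
    · exact Or.inr ⟨hw, hvw, c, ⟨hc, hr⟩, hcw.symm⟩
    · have hwT : w ∈ T := ⟨hw, fun e => hc.2.2 (e ▸ hcw.symm), hvw⟩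
      have e : (G.induce T).Adj ⟨c, hc⟩ ⟨w, hwT⟩ := hcw
      exact Or.inl ⟨hwT, hr.trans e.reachable⟩
  let S' : Finset V := S.filter fun w => w ∈ C ∨ w ∈ B
  have hCS : ∀ c ∈ C, c ∈ S' := fun c hc => mem_filter.2 ⟨hc.1.1, Or.inl hc⟩
  have hS' : S' ⊂ S := by
    refine filter_ssubset.2 ⟨v, hvS, ?_⟩
    rintro (h | h)
    · exact h.1.2.1 rfl
    · exact h.2.1.ne rfl
  suffices h : ∃ u ∈ C, G.IsClique {w | w ∈ S' ∧ G.Adj u w} by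
    obtain ⟨u, hu, hcl⟩ := h
    refine ⟨u, hu.1.1, hu.1.2.1, hu.1.2.2, hcl.subset ?_⟩
    rintro w ⟨hw, huw⟩
    exact ⟨mem_filter.2 ⟨hw, hnbr u hu w hw huw⟩, huw⟩
  by_cases hcomplete : G.IsClique (S' : Set V)
  · exact ⟨c₀, hc₀C, hcomplete.subset fun w hw => hw.1⟩
  by_cases hBuniv : ∃ b ∈ B, ∃ w ∈ S', w ≠ b ∧ ¬ G.Adj b w
  · obtain ⟨b, hb, w, hw, hwb, hbw⟩ := hBuniv
    obtain ⟨u, hu, hub, hbu, hcl⟩ := ih S' hS' (mem_filter.2 ⟨hb.1, Or.inr hb⟩) hw hwb hbw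
    exact ⟨u, (mem_filter.1 hu).2.resolve_right fun h => hbu (hB hb h hub.symm), hcl⟩
  · push Not at hBuniv
    rw [isClique_iff, Set.Pairwise] at hcomplete
    push Not at hcomplete
    obtain ⟨a, ha, b, hb, hab, hnab⟩ := hcomplete
    obtain ⟨u, hu, hua, hau, hcl⟩ := ih S' hS' ha hb hab.symm hnab
    exact ⟨u, (mem_filter.1 hu).2.resolve_right fun h =>
      hau (hBuniv u h a ha hua.symm).symm, hcl⟩

/-- A vertex set of a chordal graph other than `{v}` has a simplicial vertex different from `v`. -/
theorem SimpleGraph.Chordal.exists_simplicial_ne {V : Type*} {G : SimpleGraph V}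
    (hG : G.Chordal) (S : Finset V) (v : V) (hS : (S.erase v).Nonempty) :
    ∃ u ∈ S, u ≠ v ∧ G.IsClique {w | w ∈ S ∧ G.Adj u w} := by
  obtain ⟨a, ha⟩ := hS
  obtain ⟨hav, haS⟩ := mem_erase.1 ha
  by_cases hcomplete : G.IsClique (S : Set V)
  · exact ⟨a, haS, hav, hcomplete.subset fun w hw => hw.1⟩
  by_cases huniv : ∃ c ∈ S, v ∈ S ∧ c ≠ v ∧ ¬ G.Adj v c
  · obtain ⟨c, hcS, hvS, hcv, hvc⟩ := huniv
    obtain ⟨u, hu, huv, -, hcl⟩ := hG.exists_simplicial_of_not_adj S hvS hcS hcv hvc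
    exact ⟨u, hu, huv, hcl⟩
  · push Not at huniv
    rw [isClique_iff, Set.Pairwise] at hcomplete
    push Not at hcomplete
    obtain ⟨b, hb, c, hc, hbc, hnbc⟩ := hcomplete
    obtain ⟨u, hu, hub, hbu, hcl⟩ := hG.exists_simplicial_of_not_adj S hb hc hbc.symm hnbc
    refine ⟨u, hu, ?_, hcl⟩
    rintro rfl
    exact hbu (huniv b hb hu hub.symm).symm

theorem SimpleGraph.IsClique.exists_isMaxCliqueF_s4 {V : Type*} [Fintype V] {G : SimpleGraph V}
    {K : Finset V} (hK : G.IsClique (K : Set V)) : ∃ M, K ⊆ M ∧ G.IsMaxCliqueF M := by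
  obtain ⟨M, hKM, hM⟩ := Finite.exists_le_maximal (p := fun K : Finset V => G.IsClique K) hK
  exact ⟨M, hKM, hM.prop, fun K' hK' h => (hM.eq_of_le hK' h).symm⟩

theorem SimpleGraph.sum_le_of_mem_inducedTreeCone {V : Type*} [Fintype V] {G : SimpleGraph V}
    {p : (V → ℝ) × (Sym2 V → ℝ)} (hp : p ∈ G.inducedTreeCone) {v : V} {K : Finset V}
    (hK : G.IsClique (K : Set V)) (hv : ∀ u ∈ K, G.Adj v u) :
    ∑ u ∈ K, p.2 s(v, u) ≤ p.1 v := by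
  have hcl : G.IsClique ((insert v K : Finset V) : Set V) := by
    rw [coe_insert]
    exact hK.insert fun u hu _ => hv u hu
  obtain ⟨M, hKM, hM⟩ := hcl.exists_isMaxCliqueF_s4
  refine le_trans ?_ (hp.2.2.2 v M hM (hKM (mem_insert_self v K)))
  simp_rw [Sym2.eq_swap (a := v)]
  refine sum_le_sum_of_subset_of_nonneg (fun u hu => ?_) fun _ _ _ => hp.2.1 _
  exact mem_erase.2 ⟨(hv u hu).ne', hKM (mem_insert_of_mem hu)⟩

/-- Summing the cone inequalities along a perfect elimination ordering of `S` ending in `v`. -/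
theorem SimpleGraph.Chordal.le_sum_sub_sum_sym2 {V : Type*} [Fintype V] {G : SimpleGraph V}
    (hG : G.Chordal) {p : (V → ℝ) × (Sym2 V → ℝ)} (hp : p ∈ G.inducedTreeCone) (S : Finset V)
    {v : V} (hv : v ∈ S) : p.1 v ≤ ∑ w ∈ S, p.1 w - ∑ e ∈ S.sym2, p.2 e := by
  induction S using Finset.strongInduction with
  | H S ih =>
  rcases (S.erase v).eq_empty_or_nonempty with hS | hS
  · rcases (erase_eq_empty_iff S v).1 hS with rfl | rfl
    · simp at hv
    · have hdiag : p.2 (Sym2.diag v) = 0 := hp.2.2.1 _ (by simp)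
      simp [hdiag]
  obtain ⟨u, hu, huv, hcl⟩ := hG.exists_simplicial_ne S v hS
  have hrec := ih (S.erase u) (erase_ssubset hu) (mem_erase.2 ⟨huv.symm, hv⟩)
  have hx := add_sum_erase S p.1 hu
  have hstar : ∑ w ∈ S, p.2 s(u, w) ≤ p.1 u := by
    rw [← sum_filter_of_ne (p := fun w => G.Adj u w)]
    · exact sum_le_of_mem_inducedTreeCone hp (by simpa using hcl) fun w hw => (mem_filter.1 hw).2
    · intro w _ hw
      by_contra h
      exact hw (hp.2.2.1 _ h)
  have hsym2 : ∑ e ∈ S.sym2, p.2 e ≤ ∑ w ∈ S, p.2 s(u, w) + ∑ e ∈ (S.erase u).sym2, p.2 e := by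
    conv_lhs => rw [← insert_erase hu, sym2_insert, insert_erase hu]
    rw [← sum_image (f := p.2) (g := fun w => s(u, w)) fun a _ b _ h => Sym2.congr_right.1 h,
      ← sum_union_inter]
    exact le_add_of_nonneg_right (sum_nonneg fun _ _ => hp.2.1 _)
  linarith

/-- for chordal `G`, `T(G)` is contained in the unit cube. -/
theorem treePolyT_subset_unitCube {V : Type*} [Fintype V] (G : SimpleGraph V)
    (hG : G.Chordal) :
    ∀ p ∈ G.treePolyT,
      (∀ v, 0 ≤ p.1 v ∧ p.1 v ≤ 1) ∧ (∀ e, 0 ≤ p.2 e ∧ p.2 e ≤ 1) := by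
  rintro p ⟨hp, hsum⟩
  have hx : ∀ v, p.1 v ≤ 1 := by
    intro v
    have := hG.le_sum_sub_sum_sym2 hp univ (mem_univ v)
    rwa [sym2_univ, hsum] at this
  refine ⟨fun v => ⟨hp.1 v, hx v⟩, fun e => ⟨hp.2.1 e, ?_⟩⟩
  by_cases he : e ∈ G.edgeSet
  · induction e with
    | _ a b =>
    have := sum_le_of_mem_inducedTreeCone hp (v := a) (K := {b}) (by simp)
      (by simpa using he)
    rw [sum_singleton] at this
    exact this.trans (hx a)
  · rw [hp.2.2.1 e he]
    exact zero_le_one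
end

section
/- Let G be a finite simple graph that is not chordal, let H ⊆ V be the vertex set of a hole of G, and let v ∈ H. Then the point (x,y) defined by x_v = 2, x_w = 1 for every w ∈ H∖{v}, x_w = 0 for w ∉ H, y_e = 1 for every edge e of G with both endpoints in H, and y_e = 0 otherwise, belongs to T(G) and also to P(G); consequently neither T(G) nor P(G) is contained in the unit cube [0,1]^V × [0,1]^E. -/
open SimpleGraph Finset
open scoped Classical

/-- The graph on `V` whose edges are the edges of `G` with both ends in `H`. -/
def SimpleGraph.within {V : Type*} (G : SimpleGraph V) (H : Set V) : SimpleGraph V where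
  Adj a b := G.Adj a b ∧ a ∈ H ∧ b ∈ H
  symm := ⟨fun _ _ h => ⟨h.1.symm, h.2.2, h.2.1⟩⟩
  loopless := ⟨fun _ h => G.irrefl h.1⟩

theorem SimpleGraph.within_mem_edgeSet_iff {V : Type*} (G : SimpleGraph V) (H : Set V)
    (e : Sym2 V) : e ∈ (G.within H).edgeSet ↔ e ∈ G.edgeSet ∧ ∀ w ∈ e, w ∈ H := by
  induction e with
  | _ a b => simp [SimpleGraph.within]

theorem SimpleGraph.cycleGraph_not_triangle {n : ℕ} (hn : 4 ≤ n) {a b c : Fin n}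
    (hab : (cycleGraph n).Adj a b) (hbc : (cycleGraph n).Adj b c)
    (hac : (cycleGraph n).Adj a c) : False := by
  have step (x y : Fin n) (h : (x - y).val = 1) :
      x.val = y.val + 1 ∨ x.val + n = y.val + 1 := by
    rcases le_or_gt y x with hxy | hxy
    · have := Fin.coe_sub_iff_le.2 hxy
      omega
    · have := Fin.coe_sub_iff_lt.2 hxy
      omega
  rw [cycleGraph_adj'] at hab hbc hac
  have h1 := hab.imp (step _ _) (step _ _)
  have h2 := hbc.imp (step _ _) (step _ _)
  have h3 := hac.imp (step _ _) (step _ _)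
  omega

theorem SimpleGraph.within_not_triangle {V : Type*} {G : SimpleGraph V} {H : Set V} {n : ℕ}
    (hn : 4 ≤ n) (f : G.induce H ≃g cycleGraph n) {a b c : V} (hab : (G.within H).Adj a b)
    (hac : (G.within H).Adj a c) (hbc : G.Adj b c) : False := by
  have key (x y : V) (hx : x ∈ H) (hy : y ∈ H) (h : G.Adj x y) :
      (cycleGraph n).Adj (f ⟨x, hx⟩) (f ⟨y, hy⟩) := f.map_adj_iff.2 h
  exact cycleGraph_not_triangle hn (key a b hab.2.1 hab.2.2 hab.1)
    (key b c hab.2.2 hac.2.2 hbc) (key a c hac.2.1 hac.2.2 hac.1)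

theorem SimpleGraph.card_within_neighbors {V : Type*} [Fintype V] {G : SimpleGraph V}
    {H : Set V} {n : ℕ} (hn : 4 ≤ n) (f : G.induce H ≃g cycleGraph n) (w : V) :
    #{u | (G.within H).Adj w u} = if w ∈ H then 2 else 0 := by
  split_ifs with hw
  · obtain ⟨m, rfl⟩ : ∃ m, n = m + 3 := ⟨n - 3, by omega⟩
    have h := f.degree_eq ⟨w, hw⟩
    rw [cycleGraph_degree_three_le, ← card_neighborFinset_eq_degree] at h
    rw [h, ← Finset.card_map (Function.Embedding.subtype (· ∈ H))]
    congr 1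
    ext u
    simp [SimpleGraph.within, hw, and_comm]
  · simp [SimpleGraph.within, hw]

theorem SimpleGraph.card_clique_filter_within_le_one {V : Type*} {G : SimpleGraph V}
    {H : Set V} {n : ℕ} (hn : 4 ≤ n) (f : G.induce H ≃g cycleGraph n) (w : V) {K : Finset V}
    (hK : G.IsClique (K : Set V)) : #{u ∈ K | (G.within H).Adj w u} ≤ 1 := by
  rw [Finset.card_le_one]
  intro a ha b hb
  rw [Finset.mem_filter] at ha hb
  by_contra hab
  exact within_not_triangle hn f ha.2 hb.2 (hK ha.1 hb.1 hab)

theorem SimpleGraph.card_completeTo_filter_within_le {V : Type*} [Fintype V]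
    {G : SimpleGraph V} {H : Set V} {n : ℕ} (hn : 4 ≤ n) (f : G.induce H ≃g cycleGraph n)
    (w : V) {K : Finset V} (hK : G.IsClique (K : Set V)) :
    #{u ∈ G.completeTo (insert w K) | (G.within H).Adj w u} +
      2 * #{u ∈ K | (G.within H).Adj w u} ≤ 2 := by
  have hK1 := card_clique_filter_within_le_one hn f w hK
  obtain hK0 | ⟨a, ha⟩ := Finset.eq_empty_or_nonempty {u ∈ K | (G.within H).Adj w u}
  · have h2 : #{u ∈ G.completeTo (insert w K) | (G.within H).Adj w u} ≤
        #{u | (G.within H).Adj w u} :=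
      Finset.card_le_card (Finset.filter_subset_filter _ (Finset.subset_univ _))
    rw [card_within_neighbors hn f] at h2
    rw [hK0, Finset.card_empty]
    split_ifs at h2 <;> omega
  · rw [Finset.mem_filter] at ha
    have h0 : #{u ∈ G.completeTo (insert w K) | (G.within H).Adj w u} = 0 := by
      rw [Finset.card_eq_zero, Finset.filter_eq_empty_iff]
      intro b hb hwb
      simp only [SimpleGraph.completeTo, Finset.mem_filter] at hb
      exact within_not_triangle hn f hwb ha.2 (hb.2.2 a (Finset.mem_insert_of_mem ha.1))
    omega

theorem SimpleGraph.card_within_edgeSet {V : Type*} [Fintype V] {G : SimpleGraph V}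
    {H : Set V} {n : ℕ} (hn : 4 ≤ n) (f : G.induce H ≃g cycleGraph n) :
    #{e | e ∈ (G.within H).edgeSet} = #{w | w ∈ H} := by
  have h := (G.within H).two_mul_card_edgeFinset
  have h' : #{x : V × V | (G.within H).Adj x.1 x.2} = ∑ w : V, #{u | (G.within H).Adj w u} := by
    simp only [Finset.card_filter, Fintype.sum_prod_type]
  simp only [card_within_neighbors hn f] at h'
  rw [← Finset.sum_filter, Finset.sum_const, smul_eq_mul] at h'
  have he : (G.within H).edgeFinset = ({e | e ∈ (G.within H).edgeSet} : Finset (Sym2 V)) := by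
    ext e
    simp
  rw [he] at h
  have h'' := h.trans h'
  omega

/-- the point built from a hole `H` and `v ∈ H` belongs to `T(G)` and to
`P(G)`, hence neither polytope is contained in the unit cube. -/
theorem hole_point_mem {V : Type*} [Fintype V] (G : SimpleGraph V)
    (hG : ¬ G.Chordal) (H : Set V)
    (hH : ∃ n : ℕ, 4 ≤ n ∧ Nonempty (G.induce H ≃g SimpleGraph.cycleGraph n))
    (v : V) (hv : v ∈ H)
    (p : (V → ℝ) × (Sym2 V → ℝ))
    (hpdef : p = (fun w => if w = v then 2 else if w ∈ H then 1 else 0,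
                  fun e => if e ∈ G.edgeSet ∧ ∀ w ∈ e, w ∈ H then 1 else 0)) :
    p ∈ G.treePolyT ∧ p ∈ G.pathPolyP ∧
      ¬ (G.treePolyT ⊆
          {q | (∀ w, 0 ≤ q.1 w ∧ q.1 w ≤ 1) ∧ (∀ e, 0 ≤ q.2 e ∧ q.2 e ≤ 1)}) ∧
      ¬ (G.pathPolyP ⊆
          {q | (∀ w, 0 ≤ q.1 w ∧ q.1 w ≤ 1) ∧ (∀ e, 0 ≤ q.2 e ∧ q.2 e ≤ 1)}) := by
  obtain ⟨n, hn, ⟨f⟩⟩ := hH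
  have hx : ∀ w, p.1 w = if w = v then 2 else if w ∈ H then 1 else 0 := by simp [hpdef]
  have hy : ∀ e, p.2 e = if e ∈ (G.within H).edgeSet then 1 else 0 := by
    simp [hpdef, SimpleGraph.within_mem_edgeSet_iff]
  have hx0 : ∀ w, 0 ≤ p.1 w := fun w => by rw [hx]; split_ifs <;> norm_num
  have hx1 : ∀ w ∈ H, 1 ≤ p.1 w := fun w hw => by rw [hx, if_pos hw]; split_ifs <;> norm_num
  have hy0 : ∀ e, 0 ≤ p.2 e := fun e => by rw [hy]; split_ifs <;> norm_num
  have hyG : ∀ e, e ∉ G.edgeSet → p.2 e = 0 := fun e he => by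
    rw [hy, if_neg fun h => he ((G.within_mem_edgeSet_iff H e).1 h).1]
  have hsum : ∀ (w : V) (S : Finset V),
      ∑ u ∈ S, p.2 s(w, u) = (#{u ∈ S | (G.within H).Adj w u} : ℝ) := fun w S => by
    simp [hy, Finset.sum_boole]
  have hzero : ∀ (w : V) (S : Finset V), w ∉ H → #{u ∈ S | (G.within H).Adj w u} = 0 :=
    fun w S hw => by simp [SimpleGraph.within, hw]
  have hplane : ∑ w : V, p.1 w - ∑ e : Sym2 V, p.2 e = 1 := by
    have hX : ∑ w : V, p.1 w = #{w | w ∈ H} + 1 := by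
      have : ∀ w, p.1 w = (if w ∈ H then 1 else 0) + if w = v then 1 else 0 := fun w => by
        rw [hx]
        by_cases hwv : w = v
        · subst hwv
          norm_num [hv]
        · simp [hwv]
      simp [this, Finset.sum_add_distrib]
    have hY : ∑ e : Sym2 V, p.2 e = #{w | w ∈ H} := by
      rw [← SimpleGraph.card_within_edgeSet hn f]
      simp [hy]
    rw [hX, hY]
    ring
  have hT : p ∈ G.treePolyT := by
    refine ⟨⟨hx0, hy0, hyG, fun w K hK _ => ?_⟩, hplane⟩
    simp only [Sym2.eq_swap (b := w)]
    rw [hsum]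
    by_cases hw : w ∈ H
    · refine le_trans ?_ (hx1 w hw)
      exact_mod_cast SimpleGraph.card_clique_filter_within_le_one hn f w
        (hK.1.subset (Finset.coe_subset.2 (Finset.erase_subset w K)))
    · simpa [hzero w _ hw] using hx0 w
  have hP : p ∈ G.pathPolyP := by
    refine ⟨⟨hx0, hy0, hyG, fun w K _ hK => ?_⟩, hplane⟩
    rw [hsum, hsum]
    by_cases hw : w ∈ H
    · have h : (#{u ∈ G.completeTo (insert w K) | (G.within H).Adj w u} : ℝ) +
          2 * #{u ∈ K | (G.within H).Adj w u} ≤ 2 :=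
        mod_cast SimpleGraph.card_completeTo_filter_within_le hn f w hK
      linarith [hx1 w hw]
    · simpa [hzero w _ hw] using hx0 w
  have hcube : ¬ p.1 v ≤ 1 := by norm_num [hx]
  exact ⟨hT, hP, fun h => hcube ((h hT).1 v).2, fun h => hcube ((h hP).1 v).2⟩
end

section
/- Let G be a finite simple chordal graph and let P₁, P₂ be induced paths of G that share a common extremity u, with |P₁|, |P₂| ≥ 2. Let u₁ be the neighbor of u on P₁ and u₂ the neighbor of u on P₂, and assume u₁ ≠ u₂. Then either u₁ and u₂ are adjacent in G, or P₁ ∪ P₂ is an induced path of G. -/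
open SimpleGraph Finset
open scoped Classical

/-- `p 0, …, p n` are the consecutive vertices of an induced path of `G`. -/
def SimpleGraph.IsInducedPathSeq {V : Type*} (G : SimpleGraph V) (n : ℕ) (p : ℕ → V) : Prop :=
  ∀ a ≤ n, ∀ b ≤ n, (G.Adj (p a) (p b) ↔ a + 1 = b ∨ b + 1 = a) ∧ (p a = p b → a = b)

/-- Follow `p` backwards from `p i` to `p 0`, then follow `q` forwards. -/
def glueSeq {V : Type*} (p q : ℕ → V) (i k : ℕ) : V :=
  if k ≤ i then p (i - k) else q (k - i)

/-- An injective map that preserves and reflects adjacency identifies its domain with the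
subgraph induced by its range. -/
theorem SimpleGraph.nonempty_induce_iso_of_range_eq {V ι : Type*} (G : SimpleGraph V)
    (H : SimpleGraph ι) (f : ι → V) (hf : Function.Injective f)
    (hadj : ∀ a b, G.Adj (f a) (f b) ↔ H.Adj a b) (W : Set V) (hW : W = Set.range f) :
    Nonempty (G.induce W ≃g H) := by
  subst hW
  exact ⟨(RelIso.mk (Equiv.ofInjective f hf) (fun {a b} => hadj a b) :
    H ≃g G.induce (Set.range f)).symm⟩

theorem SimpleGraph.IsInducedPath.exists_seq {V : Type*} {G : SimpleGraph V} {W : Finset V}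
    (h : G.IsInducedPath W) {u : V} (hu : G.IsExtremity u W) :
    ∃ (n : ℕ) (p : ℕ → V), p 0 = u ∧ G.IsInducedPathSeq n p ∧
      ∀ v, v ∈ W ↔ ∃ a ≤ n, p a = v := by
  obtain ⟨n, hn, ⟨e⟩⟩ := h
  obtain ⟨huW, hdeg⟩ := hu
  obtain ⟨n, rfl⟩ : ∃ k, n = k + 1 := ⟨n - 1, by omega⟩
  set p : ℕ → V := fun a => (e.symm (Fin.ofNat (n + 1) a) : V) with hp
  have hval : ∀ a ≤ n, (Fin.ofNat (n + 1) a).val = a := fun a ha => by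
    simp only [Fin.ofNat]
    exact Nat.mod_eq_of_lt (by omega)
  have hmem : ∀ a, p a ∈ W := fun a => (e.symm (Fin.ofNat (n + 1) a)).2
  have hseq : G.IsInducedPathSeq n p := by
    intro a ha b hb
    constructor
    · have hiso : G.Adj (p a) (p b) ↔
          (pathGraph (n + 1)).Adj (Fin.ofNat (n + 1) a) (Fin.ofNat (n + 1) b) :=
        e.symm.map_adj_iff (v := Fin.ofNat (n + 1) a) (w := Fin.ofNat (n + 1) b)
      rw [hiso, pathGraph_adj, hval a ha, hval b hb]
    · intro hab
      have := congrArg Fin.val (e.symm.injective (Subtype.ext hab))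
      rwa [hval a ha, hval b hb] at this
  have hcover : ∀ v, v ∈ W ↔ ∃ a ≤ n, p a = v := by
    intro v
    constructor
    · intro hv
      refine ⟨(e ⟨v, hv⟩).val, by omega, ?_⟩
      simp [hp]
    · rintro ⟨a, -, rfl⟩
      exact hmem a
  obtain ⟨k, hk, rfl⟩ := (hcover u).1 huW
  rcases Nat.eq_zero_or_pos k with rfl | hpos
  · exact ⟨n, p, rfl, hseq, hcover⟩
  obtain rfl : k = n := by
    by_contra hkn
    have := Finset.card_le_one.1 hdeg (p (k - 1))
      (by simpa [hmem] using (hseq k hk (k - 1) (by omega)).1.2 (by omega)) (p (k + 1))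
      (by simpa [hmem] using (hseq k hk (k + 1) (by omega)).1.2 (by omega))
    have := (hseq (k - 1) (by omega) (k + 1) (by omega)).2 this
    omega
  refine ⟨k, fun a => p (k - a), rfl, ?_, ?_⟩
  · intro a ha b hb
    obtain ⟨h₁, h₂⟩ := hseq (k - a) (by omega) (k - b) (by omega)
    exact ⟨h₁.trans (by omega), fun h => by have := h₂ h; omega⟩
  · intro v
    rw [hcover]
    constructor
    · rintro ⟨a, ha, rfl⟩
      exact ⟨k - a, by omega, by simp only [Nat.sub_sub_self ha]⟩
    · rintro ⟨a, ha, rfl⟩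
      exact ⟨k - a, by omega, rfl⟩

/-- Two induced path sequences with a common start and otherwise disjoint and non-adjacent,
except possibly between their ends: the glued sequence is injective, and its adjacency is that
of a path plus possibly an edge closing a cycle. -/
theorem SimpleGraph.IsInducedPathSeq.glueSeq_spec {V : Type*} {G : SimpleGraph V} {i j : ℕ}
    {p q : ℕ → V} (hp : G.IsInducedPathSeq i p) (hq : G.IsInducedPathSeq j q)
    (h0 : p 0 = q 0) (c : Prop)
    (hpq : ∀ a b, 1 ≤ a → a ≤ i → 1 ≤ b → b ≤ j →
      p a ≠ q b ∧ (G.Adj (p a) (q b) ↔ c ∧ a = i ∧ b = j))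
    (hc : c → 1 ≤ i ∧ 1 ≤ j) :
    ∀ a ≤ i + j, ∀ b ≤ i + j,
      (G.Adj (glueSeq p q i a) (glueSeq p q i b) ↔ a + 1 = b ∨ b + 1 = a ∨
        c ∧ (a = 0 ∧ b = i + j ∨ b = 0 ∧ a = i + j)) ∧
      (glueSeq p q i a = glueSeq p q i b → a = b) := by
  have key : ∀ a ≤ i, ∀ b, i < b → b ≤ i + j →
      (G.Adj (p (i - a)) (q (b - i)) ↔ a + 1 = b ∨ c ∧ a = 0 ∧ b = i + j) ∧
      p (i - a) ≠ q (b - i) := by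
    intro a ha b hib hb
    rcases Nat.eq_or_lt_of_le ha with rfl | hai
    · rw [Nat.sub_self, h0]
      obtain ⟨h₁, h₂⟩ := hq 0 (by omega) (b - a) (by omega)
      refine ⟨h₁.trans ?_, fun h => by have := h₂ h; omega⟩
      constructor
      · intro h; left; omega
      · rintro (h | ⟨h, h', -⟩)
        · omega
        · have := hc h; omega
    · obtain ⟨h₁, h₂⟩ := hpq (i - a) (b - i) (by omega) (by omega) (by omega) (by omega)
      refine ⟨h₂.trans ?_, h₁⟩
      constructor
      · rintro ⟨h, h', h''⟩
        exact Or.inr ⟨h, by omega, by omega⟩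
      · rintro (h | ⟨h, h', h''⟩)
        · omega
        · exact ⟨h, by omega, by omega⟩
  intro a ha b hb
  unfold glueSeq
  split_ifs with hai hbi hbi
  · obtain ⟨h₁, h₂⟩ := hp (i - a) (by omega) (i - b) (by omega)
    refine ⟨h₁.trans ?_, fun h => by have := h₂ h; omega⟩
    constructor
    · intro h; omega
    · rintro (h | h | ⟨h, h'⟩)
      · omega
      · omega
      · have := hc h; omega
  · obtain ⟨h₁, h₂⟩ := key a hai b (by omega) hb
    refine ⟨h₁.trans ?_, fun h => absurd h h₂⟩
    constructor
    · rintro (h | ⟨h, h'⟩)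
      · exact Or.inl h
      · exact Or.inr (Or.inr ⟨h, Or.inl h'⟩)
    · rintro (h | h | ⟨h, h' | h'⟩)
      · exact Or.inl h
      · omega
      · exact Or.inr ⟨h, h'⟩
      · omega
  · obtain ⟨h₁, h₂⟩ := key b hbi a (by omega) ha
    refine ⟨(G.adj_comm _ _).trans (h₁.trans ?_), fun h => absurd h.symm h₂⟩
    constructor
    · rintro (h | ⟨h, h'⟩)
      · exact Or.inr (Or.inl h)
      · exact Or.inr (Or.inr ⟨h, Or.inr h'⟩)
    · rintro (h | h | ⟨h, h' | h'⟩)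
      · omega
      · exact Or.inl h
      · omega
      · exact Or.inr ⟨h, h'⟩
  · obtain ⟨h₁, h₂⟩ := hq (a - i) (by omega) (b - i) (by omega)
    refine ⟨h₁.trans ?_, fun h => by have := h₂ h; omega⟩
    constructor
    · intro h; omega
    · rintro (h | h | ⟨h, h'⟩)
      · omega
      · omega
      · omega

theorem SimpleGraph.IsInducedPathSeq.mono {V : Type*} {G : SimpleGraph V} {n m : ℕ} {p : ℕ → V}
    (hp : G.IsInducedPathSeq n p) (hmn : m ≤ n) : G.IsInducedPathSeq m p :=
  fun a ha b hb => hp a (ha.trans hmn) b (hb.trans hmn)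

/-- Two vertices of `cycleGraph n` are adjacent iff they are consecutive or the two ends. -/
theorem SimpleGraph.cycleGraph_adj_iff_val {n : ℕ} (hn : 2 ≤ n) (a b : Fin n) :
    (cycleGraph n).Adj a b ↔ a.val + 1 = b.val ∨ b.val + 1 = a.val ∨
      (a.val = 0 ∧ b.val + 1 = n ∨ b.val = 0 ∧ a.val + 1 = n) := by
  have hsub : ∀ x y : Fin n, (x - y).val = 1 ↔ y.val + 1 = x.val ∨ x.val = 0 ∧ y.val + 1 = n := by
    intro x y
    rcases le_or_gt y x with h | h
    · rw [Fin.sub_val_of_le h]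
      have : y.val ≤ x.val := h
      omega
    · rw [Fin.coe_sub_iff_lt.2 h]
      have : x.val < y.val := h
      omega
  rw [cycleGraph_adj', hsub, hsub]
  tauto

theorem SimpleGraph.HasHole.of_seq {V : Type*} {G : SimpleGraph V} {n : ℕ} (hn : 3 ≤ n)
    (f : ℕ → V)
    (hf : ∀ a ≤ n, ∀ b ≤ n,
      (G.Adj (f a) (f b) ↔ a + 1 = b ∨ b + 1 = a ∨ (a = 0 ∧ b = n ∨ b = 0 ∧ a = n)) ∧
      (f a = f b → a = b)) : G.HasHole := by
  refine ⟨_, n + 1, by omega, G.nonempty_induce_iso_of_range_eq (cycleGraph (n + 1))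
    (fun a => f a) ?_ ?_ _ rfl⟩
  · intro a b h
    exact Fin.ext ((hf a (by omega) b (by omega)).2 h)
  · intro a b
    rw [cycleGraph_adj_iff_val (by omega), (hf a (by omega) b (by omega)).1]
    omega

theorem SimpleGraph.IsInducedPathSeq.isInducedPath {V : Type*} {G : SimpleGraph V} {n : ℕ}
    {f : ℕ → V} (hf : G.IsInducedPathSeq n f) {W : Finset V}
    (hW : ∀ v, v ∈ W ↔ ∃ a ≤ n, f a = v) : G.IsInducedPath W := by
  refine ⟨n + 1, by omega, G.nonempty_induce_iso_of_range_eq (pathGraph (n + 1))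
    (fun a => f a) ?_ ?_ _ ?_⟩
  · intro a b h
    exact Fin.ext ((hf a (by omega) b (by omega)).2 h)
  · intro a b
    rw [pathGraph_adj, (hf a (by omega) b (by omega)).1]
  · ext v
    rw [Finset.mem_coe, hW]
    constructor
    · rintro ⟨a, ha, rfl⟩
      exact ⟨⟨a, by omega⟩, rfl⟩
    · rintro ⟨a, rfl⟩
      exact ⟨a, by omega, rfl⟩

/-- In a chordal graph, two induced path sequences with a common start whose second vertices are
distinct and non-adjacent do not meet or touch again. -/
theorem SimpleGraph.Chordal.ne_and_not_adj_of_seq {V : Type*} {G : SimpleGraph V}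
    (hG : G.Chordal) {m n : ℕ} {p q : ℕ → V} (hp : G.IsInducedPathSeq m p)
    (hq : G.IsInducedPathSeq n q) (h0 : p 0 = q 0) (hne : p 1 ≠ q 1) (hadj : ¬ G.Adj (p 1) (q 1)) :
    ∀ i j, 1 ≤ i → i ≤ m → 1 ≤ j → j ≤ n → p i ≠ q j ∧ ¬ G.Adj (p i) (q j) := by
  suffices h : ∀ s i j, i + j = s → 1 ≤ i → i ≤ m → 1 ≤ j → j ≤ n →
      p i ≠ q j ∧ ¬ G.Adj (p i) (q j) from fun i j => h _ i j rfl
  intro s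
  induction s using Nat.strong_induction_on with
  | _ s ih =>
    rintro i j rfl hi him hj hjn
    by_cases h11 : i = 1 ∧ j = 1
    · obtain ⟨rfl, rfl⟩ := h11
      exact ⟨hne, hadj⟩
    have hij : p i ≠ q j := by
      intro h
      rcases Nat.lt_or_ge 1 i with h1 | h1
      · refine (ih (i - 1 + j) (by omega) (i - 1) j rfl (by omega) (by omega) hj hjn).2 ?_
        rw [← h]
        exact (hp _ (by omega) _ him).1.2 (by omega)
      · refine (ih (i + (j - 1)) (by omega) i (j - 1) rfl hi him (by omega) (by omega)).2 ?_
        rw [h]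
        exact (hq _ hjn _ (by omega)).1.2 (by omega)
    refine ⟨hij, fun hA => hG (HasHole.of_seq (n := i + j) (by omega) (glueSeq p q i) ?_)⟩
    have := (hp.mono him).glueSeq_spec (hq.mono hjn) h0 True ?_ fun _ => ⟨hi, hj⟩
    · simpa only [true_and] using this
    intro a b ha hai hb hbj
    by_cases hab : a = i ∧ b = j
    · obtain ⟨rfl, rfl⟩ := hab
      exact ⟨hij, by simpa using hA⟩
    · obtain ⟨h₁, h₂⟩ :=
        ih (a + b) (by omega) a b rfl ha (hai.trans him) hb (hbj.trans hjn)
      exact ⟨h₁, by simpa [h₂] using hab⟩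

/-- two induced paths of a chordal graph sharing an extremity `u` with
distinct neighbors `u₁ ≠ u₂` of `u`: either `u₁u₂` is an edge or the union is an
induced path. -/
theorem induced_paths_common_extremity {V : Type*} [Fintype V] (G : SimpleGraph V)
    (hG : G.Chordal)
    (P₁ P₂ : Finset V) (h1 : G.IsInducedPath P₁) (h2 : G.IsInducedPath P₂)
    (u u₁ u₂ : V)
    (hext1 : G.IsExtremity u P₁) (hext2 : G.IsExtremity u P₂)
    (hcard1 : 2 ≤ P₁.card) (hcard2 : 2 ≤ P₂.card)
    (hm1 : u₁ ∈ P₁) (ha1 : G.Adj u u₁) (hm2 : u₂ ∈ P₂) (ha2 : G.Adj u u₂)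
    (hne : u₁ ≠ u₂) :
    G.Adj u₁ u₂ ∨ G.IsInducedPath (P₁ ∪ P₂) := by
  obtain ⟨m, p, rfl, hp, hpW⟩ := h1.exists_seq hext1
  obtain ⟨n, q, h0, hq, hqW⟩ := h2.exists_seq hext2
  rw [or_iff_not_imp_left]
  intro hadj
  obtain ⟨a, ham, rfl⟩ := (hpW u₁).1 hm1
  obtain ⟨b, hbn, rfl⟩ := (hqW u₂).1 hm2
  obtain rfl : a = 1 := by
    have := (hp 0 (by omega) a ham).1.1 ha1
    omega
  obtain rfl : b = 1 := by
    have := (hq 0 (by omega) b hbn).1.1 (h0 ▸ ha2)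
    omega
  have hsep := hG.ne_and_not_adj_of_seq hp hq h0.symm hne hadj
  have hglue := hp.glueSeq_spec hq h0.symm False
    (fun a b ha ham hb hbn => by
      obtain ⟨h₁, h₂⟩ := hsep a b ha ham hb hbn
      exact ⟨h₁, by simpa using h₂⟩) False.elim
  refine IsInducedPathSeq.isInducedPath (n := m + n) (f := glueSeq p q m) ?_ ?_
  · simpa only [IsInducedPathSeq, false_and, or_false] using hglue
  intro v
  rw [Finset.mem_union, hpW, hqW]
  constructor
  · rintro (⟨a, ha, rfl⟩ | ⟨b, hb, rfl⟩)
    · exact ⟨m - a, by omega, by simp [glueSeq, Nat.sub_sub_self ha]⟩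
    · rcases Nat.eq_zero_or_pos b with rfl | hpos
      · exact ⟨m, by omega, by simp [glueSeq, h0]⟩
      · refine ⟨m + b, by omega, ?_⟩
        rw [glueSeq, if_neg (by omega), Nat.add_sub_cancel_left]
  · rintro ⟨a, ha, rfl⟩
    unfold glueSeq
    split_ifs with h
    · exact Or.inl ⟨m - a, by omega, rfl⟩
    · exact Or.inr ⟨a - m, by omega, rfl⟩
end
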